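/- If G ∈ G*, then the list chromatic index of G equals its chromatic index: χ'_ℓ(G) = χ'(G). -/

import Mathlib

open SimpleGraph

/-- Adjacency in the line graph `L(G)`: two distinct edges sharing an endpoint. -/
def lineAdj {V : Type*} (G : SimpleGraph V) (e f : G.edgeSet) : Prop :=
  e ≠ f ∧ ∃ x : V, x ∈ (e : Sym2 V) ∧ x ∈ (f : Sym2 V)

/-- `D` is an orientation of the (loopless) adjacency relation `Adj`:
every arc of `D` is an edge, and every edge gets at least one of its two arcs. -/
def IsOrientation {α : Type*} (Adj : α → α → Prop) (D : α → α → Prop) : Prop :=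
  (∀ a b, D a b → Adj a b) ∧ (∀ a b, Adj a b → D a b ∨ D b a)

/-- A digraph (relation) is kernel-perfect if every induced subdigraph has a kernel:
an independent set `S` such that every vertex outside `S` has an out-neighbor in `S`. -/
def KernelPerfect {α : Type*} (D : α → α → Prop) : Prop :=
  ∀ Z : Set α, ∃ S ⊆ Z, (∀ a ∈ S, ∀ b ∈ S, ¬ D a b) ∧
    ∀ z ∈ Z, z ∉ S → ∃ s ∈ S, D z s

/-- Out-degree of a vertex in a digraph given as a relation. -/
noncomputable def outDeg {α : Type*} (D : α → α → Prop) (a : α) : ℕ := {b | D a b}.ncard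

/-- Degree of a vertex. -/
noncomputable def deg {V : Type*} (G : SimpleGraph V) (v : V) : ℕ := (G.neighborSet v).ncard

/-- Maximum degree. -/
noncomputable def maxDeg {V : Type*} (G : SimpleGraph V) : ℕ := sSup (Set.range (deg G))

/-- `G` is `f`-edge-orientable: `L(G)` admits a kernel-perfect orientation with
`1 + d⁺(e) ≤ f e` for every edge `e`. -/
def EdgeOrientable {V : Type*} (G : SimpleGraph V) (f : G.edgeSet → ℕ) : Prop :=
  ∃ D : G.edgeSet → G.edgeSet → Prop,
    IsOrientation (lineAdj G) D ∧ KernelPerfect D ∧ ∀ e, outDeg D e + 1 ≤ f e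

open Classical in
/-- The function `f_{k,v}`: `deg v` on edges incident to `v`, and `k` elsewhere. -/
noncomputable def fkv {V : Type*} (G : SimpleGraph V) (k : ℕ) (v : V) (e : G.edgeSet) : ℕ :=
  if v ∈ (e : Sym2 V) then deg G v else k

/-- `G` is strongly `k`-edge-orientable. -/
def StronglyEdgeOrientable {V : Type*} (G : SimpleGraph V) (k : ℕ) : Prop :=
  ∀ v : V, EdgeOrientable G (fkv G k v)

/-- `G` is `f`-edge-choosable. -/
def FEdgeChoosable {V : Type*} (G : SimpleGraph V) (f : G.edgeSet → ℕ) : Prop :=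
  ∀ ℓ : G.edgeSet → Finset ℕ, (∀ e, f e ≤ (ℓ e).card) →
    ∃ φ : G.edgeSet → ℕ, (∀ e, φ e ∈ ℓ e) ∧
      ∀ e₁ e₂, lineAdj G e₁ e₂ → φ e₁ ≠ φ e₂

/-- `G ∈ G*`: any two distinct odd cycles share at most one edge. -/
def InGStar {V : Type*} (G : SimpleGraph V) : Prop :=
  ∀ (u w : V) (c₁ : G.Walk u u) (c₂ : G.Walk w w),
    c₁.IsCycle → c₂.IsCycle → Odd c₁.length → Odd c₂.length →
    {e | e ∈ c₁.edges} ≠ {e | e ∈ c₂.edges} →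
    ({e | e ∈ c₁.edges} ∩ {e | e ∈ c₂.edges}).ncard ≤ 1

/-- `G` is 2-connected: connected, and still connected after deleting any one vertex. -/
def TwoConn {V : Type*} (G : SimpleGraph V) : Prop :=
  G.Connected ∧ ∀ v : V, (G.induce {w | w ≠ v}).Connected

/-- A block of `G`: a maximal 2-connected subgraph. -/
def IsBlock {V : Type*} (G : SimpleGraph V) (B : G.Subgraph) : Prop :=
  TwoConn B.coe ∧ ∀ B' : G.Subgraph, TwoConn B'.coe → B ≤ B' → B = B'

/-- Vertex type of the theta graph with path lengths `l`: two hubs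
(`Sum.inl false`, `Sum.inl true`) plus the internal vertices of each path. -/
def ThetaVert (l : List ℕ) : Type := Bool ⊕ (Σ i : Fin l.length, Fin (l.get i - 1))

/-- The theta graph `Θ_{l₁,…,l_k}`: two hubs joined by internally disjoint paths,
the `i`-th of length `l i`. -/
def thetaGraph (l : List ℕ) : SimpleGraph (ThetaVert l) :=
  SimpleGraph.fromRel (fun a b =>
    match a, b with
    | Sum.inl false, Sum.inl true => 1 ∈ l
    | Sum.inl false, Sum.inr ⟨_, j⟩ => j.val = 0
    | Sum.inl true, Sum.inr ⟨i, j⟩ => j.val = l.get i - 2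
    | Sum.inr ⟨i, j⟩, Sum.inr ⟨i', j'⟩ => i.val = i'.val ∧ j'.val = j.val + 1
    | _, _ => False)

/-- `v` (outside `c`) touches `w ∈ c`: some `v,w`-path meets `c` only at `w`. -/
def Touches {V : Type*} (G : SimpleGraph V) {u : V} (c : G.Walk u u) (v w : V) : Prop :=
  w ∈ c.support ∧ ∃ p : G.Walk v w, p.IsPath ∧ ∀ x ∈ p.support, x ∈ c.support → x = w

/-- The chromatic index `χ'(G)`: least `n` admitting a proper edge coloring
with colors `< n`. -/
noncomputable def chromIndex {V : Type*} (G : SimpleGraph V) : ℕ :=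
  sInf {n | ∃ φ : G.edgeSet → ℕ, (∀ e, φ e < n) ∧
    ∀ e₁ e₂, lineAdj G e₁ e₂ → φ e₁ ≠ φ e₂}

/-- The list chromatic index `χ'_ℓ(G)`: least `n` such that `G` is
`n`-edge-choosable. -/
noncomputable def listChromIndex {V : Type*} (G : SimpleGraph V) : ℕ :=
  sInf {n | FEdgeChoosable G (fun _ => n)}

/-- `G` contains an `a`-`b` path of length `n` whose vertex set is `A`. -/
def HasPath {V : Type*} (G : SimpleGraph V) (a b : V) (n : ℕ) (A : Set V) : Prop :=
  ∃ p : G.Walk a b, p.IsPath ∧ p.length = n ∧ ∀ z, z ∈ A ↔ z ∈ p.support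

/-- `G` is not the union of two nonempty subgraphs sharing at most one vertex. -/
def Nonseparable {V : Type*} (G : SimpleGraph V) : Prop :=
  ∀ (w : V) (G₁ G₂ : SimpleGraph V), G₁ ⊔ G₂ = G →
    (∀ v, v ≠ w → ∀ x y, G₁.Adj v x → ¬ G₂.Adj v y) → G₁ = ⊥ ∨ G₂ = ⊥

section Paths

variable {V : Type*} {G : SimpleGraph V} {a b c : V} {m n p q s : ℕ} {A B P Q S : Set V}

lemma HasPath.symm (h : HasPath G a b n A) : HasPath G b a n A := by
  obtain ⟨p, hp, hn, hA⟩ := h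
  exact ⟨p.reverse, hp.reverse, by simpa using hn, by simpa using hA⟩

lemma HasPath.left_mem (h : HasPath G a b n A) : a ∈ A := by
  obtain ⟨p, hp, hn, hA⟩ := h
  simp [hA]

lemma HasPath.right_mem (h : HasPath G a b n A) : b ∈ A := h.symm.left_mem

lemma HasPath.pos (h : HasPath G a b n A) (hab : a ≠ b) : 1 ≤ n := by
  obtain ⟨p, hp, rfl, hA⟩ := h
  by_contra hn
  exact hab (Walk.eq_of_length_eq_zero (p := p) (by omega))

lemma HasPath.of_adj (h : G.Adj a b) : HasPath G a b 1 {a, b} :=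
  ⟨h.toWalk, h.isPath_toWalk, by simp, by simp⟩

lemma HasPath.append (h₁ : HasPath G a c m A) (h₂ : HasPath G c b n B)
    (h : ∀ z, z ∈ A → z ∈ B → z = c) : HasPath G a b (m + n) (A ∪ B) := by
  obtain ⟨p, hp, rfl, hA⟩ := h₁
  obtain ⟨q, hq, rfl, hB⟩ := h₂
  refine ⟨p.append q, ?_, by simp, by simp [Walk.mem_support_append_iff, hA, hB]⟩
  rw [Walk.isPath_def, Walk.support_append, List.nodup_append']
  refine ⟨hp.support_nodup, hq.support_nodup.tail, ?_⟩
  intro z hz hz'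
  have hzc : z = c := h z ((hA z).2 hz) ((hB z).2 (List.mem_of_mem_tail hz'))
  have := hq.support_nodup
  rw [← Walk.cons_tail_support] at this
  exact (List.nodup_cons.1 this).1 (hzc ▸ hz')

lemma HasPath.split (h : HasPath G a b n A) (hc : c ∈ A) :
    ∃ n₁ n₂ A₁ A₂, HasPath G a c n₁ A₁ ∧ HasPath G c b n₂ A₂ ∧ n = n₁ + n₂ ∧
      (∀ z, z ∈ A ↔ z ∈ A₁ ∨ z ∈ A₂) ∧ ∀ z, z ∈ A₁ → z ∈ A₂ → z = c := by
  obtain ⟨p, hp, rfl, hA⟩ := h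
  obtain ⟨q, r, hq, hr, rfl⟩ := hp.mem_support_iff_exists_append.1 ((hA c).1 hc)
  refine ⟨_, _, {z | z ∈ q.support}, {z | z ∈ r.support}, ⟨q, hq, rfl, by simp⟩,
    ⟨r, hr, rfl, by simp⟩, by simp, by simp [hA, Walk.mem_support_append_iff], ?_⟩
  intro z hz hz'
  by_contra hzc
  have := hp.support_nodup
  rw [Walk.support_append, List.nodup_append'] at this
  have hz'' : z ∈ r.support := hz'
  rw [← Walk.cons_tail_support, List.mem_cons] at hz''
  exact this.2.2 hz (hz''.resolve_left hzc)

lemma HasPath.uncons (h : HasPath G a b n A) (hab : a ≠ b) :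
    ∃ u A', G.Adj a u ∧ HasPath G u b (n - 1) A' ∧ a ∉ A' ∧ ∀ z, z ∈ A ↔ z = a ∨ z ∈ A' := by
  obtain ⟨p, hp, rfl, hA⟩ := h
  cases p with
  | nil => exact absurd rfl hab
  | cons hu r =>
    rw [Walk.cons_isPath_iff] at hp
    exact ⟨_, {z | z ∈ r.support}, hu, ⟨r, hp.1, by simp, by simp⟩, hp.2, by simpa using hA⟩

lemma isCycle_append_reverse {p q : G.Walk a b} (hp : p.IsPath) (hq : q.IsPath)
    (hpq : ∀ z, z ∈ p.support → z ∈ q.support → z = a ∨ z = b)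
    (h : 1 < p.length ∨ 1 < q.length) : (p.append q.reverse).IsCycle := by
  refine hp.isCycle_append hq.reverse ?_ (by simpa using h)
  intro z hz hz'
  have hp' := hp.support_nodup
  rw [← Walk.cons_tail_support] at hp'
  have hq' := hq.reverse.support_nodup
  rw [← Walk.cons_tail_support] at hq'
  rcases hpq z (List.mem_of_mem_tail hz) (by simpa using List.mem_of_mem_tail hz') with rfl | rfl
  · exact (List.nodup_cons.1 hp').1 hz
  · exact (List.nodup_cons.1 hq').1 hz'

lemma length_le_one_of_edges_subset {p q s : G.Walk a b} (hp : p.IsPath) (hab : a ≠ b)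
    (hpq : ∀ z, z ∈ p.support → z ∈ q.support → z = a ∨ z = b)
    (hps : ∀ z, z ∈ p.support → z ∈ s.support → z = a ∨ z = b)
    (h : ∀ e ∈ p.edges, e ∈ s.edges ∨ e ∈ q.edges) : p.length ≤ 1 := by
  cases p with
  | nil => exact absurd rfl hab
  | @cons _ c _ hu r =>
    have hc : c = a ∨ c = b := by
      rcases h s(a, c) (by simp) with h | h
      · exact hps c (by simp) (Walk.snd_mem_support_of_mem_edges _ h)
      · exact hpq c (by simp) (Walk.snd_mem_support_of_mem_edges _ h)
    rcases hc with rfl | rfl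
    · exact absurd rfl hu.ne
    · rw [Walk.cons_isPath_iff, Walk.isPath_iff_nil] at hp
      simp [hp.1.eq_nil]

/-- Two odd cycles of a theta graph in a graph of `G*` share at most one edge. -/
lemma InGStar.theta (hG : InGStar G) (hab : a ≠ b) (hP : HasPath G a b p P)
    (hS : HasPath G a b s S) (hQ : HasPath G a b q Q)
    (hPQ : ∀ z, z ∈ P → z ∈ Q → z = a ∨ z = b) (hSQ : ∀ z, z ∈ S → z ∈ Q → z = a ∨ z = b)
    (hPS : ∀ z, z ∈ P → z ∈ S → z = a ∨ z = b) (hpq : Odd (p + q)) (hsq : Odd (s + q))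
    (hq : 2 ≤ q) : p = 1 ∧ s = 1 := by
  have hp1 := hP.pos hab
  have hs1 := hS.pos hab
  obtain ⟨p, hp, rfl, hP⟩ := hP
  obtain ⟨s, hs, rfl, hS⟩ := hS
  obtain ⟨q, hq', rfl, hQ⟩ := hQ
  simp only [hP, hQ, hS] at hPQ hSQ hPS
  have key := hG a a _ _ (isCycle_append_reverse hp hq' hPQ (Or.inr hq))
    (isCycle_append_reverse hs hq' hSQ (Or.inr hq)) (by simpa using hpq) (by simpa using hsq)
  by_cases heq : {e | e ∈ (p.append q.reverse).edges} = {e | e ∈ (s.append q.reverse).edges}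
  · have heq' : ∀ e, (e ∈ p.edges ∨ e ∈ q.edges) ↔ (e ∈ s.edges ∨ e ∈ q.edges) := by
      intro e
      simpa using Set.ext_iff.1 heq e
    have h1 := length_le_one_of_edges_subset hp hab hPQ hPS
      fun e he => (heq' e).1 (Or.inl he)
    have h2 := length_le_one_of_edges_subset hs hab hSQ (fun z h h' => hPS z h' h)
      fun e he => (heq' e).2 (Or.inl he)
    omega
  · have h1 := key heq
    classical
    have h2 : ((q.edges.toFinset : Set (Sym2 V))).ncard ≤
        ({e | e ∈ (p.append q.reverse).edges} ∩
          {e | e ∈ (s.append q.reverse).edges}).ncard := by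
      apply Set.ncard_le_ncard
      · intro e he
        have : e ∈ q.edges := by simpa using he
        simp [this]
      · exact (List.finite_toSet _).inter_of_left _
    rw [Set.ncard_coe_finset, List.toFinset_card_of_nodup hq'.isTrail.edges_nodup,
      Walk.length_edges] at h2
    omega

/-- If `U` can only be left through `w` and contains an edge, it contains all edges. -/
lemma Nonseparable.mem_of_adj (hG : Nonseparable G) {U : Set V} (w : V)
    (hU : ∀ x ∈ U, x ≠ w → ∀ y, G.Adj x y → y ∈ U) (ha : a ∈ U) (hb : b ∈ U) (hab : G.Adj a b)
    {x y : V} (hxy : G.Adj x y) : x ∈ U := by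
  let G₁ : SimpleGraph V :=
    { Adj := fun x y => G.Adj x y ∧ x ∈ U ∧ y ∈ U
      symm := ⟨fun x y h => ⟨h.1.symm, h.2.2, h.2.1⟩⟩
      loopless := ⟨fun x h => G.loopless.irrefl x h.1⟩ }
  let G₂ : SimpleGraph V :=
    { Adj := fun x y => G.Adj x y ∧ ¬ (x ∈ U ∧ y ∈ U)
      symm := ⟨fun x y h => ⟨h.1.symm, fun h' => h.2 ⟨h'.2, h'.1⟩⟩⟩
      loopless := ⟨fun x h => G.loopless.irrefl x h.1⟩ }
  rcases hG w G₁ G₂ (by ext x y; simp only [sup_adj, G₁, G₂]; tauto)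
    (fun v hv x y h₁ h₂ => h₂.2 ⟨h₁.2.1, hU v h₁.2.1 hv y h₂.1⟩) with h | h
  · exact absurd (show G₁.Adj a b from ⟨hab, ha, hb⟩) (by simp [h])
  · by_contra hx
    exact absurd (show G₂.Adj x y from ⟨hxy, fun h => hx h.1⟩) (by simp [h])

/-- An edge leaving `W` extends to a path that returns to `W` at another vertex. -/
lemma Nonseparable.exists_ear (hG : Nonseparable G) {W : Set V} {x y c d : V} (hx : x ∈ W)
    (hy : y ∉ W) (hxy : G.Adj x y) (hc : c ∈ W) (hd : d ∈ W) (hcd : G.Adj c d) :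
    ∃ x' ∈ W, x' ≠ x ∧ ∃ n A, 2 ≤ n ∧ HasPath G x x' n A ∧ y ∈ A ∧
      ∀ z, z ∈ A → z ∈ W → z = x ∨ z = x' := by
  classical
  let K : Set V := {z | ∃ q : G.Walk y z, ∀ v ∈ q.support, v ∉ W}
  have hyK : y ∈ K := ⟨Walk.nil, by simpa using hy⟩
  have : ∃ z ∈ K, ∃ x' ∈ W, x' ≠ x ∧ G.Adj z x' := by
    by_contra! hcon
    have hU : ∀ z ∈ insert x K, z ≠ x → ∀ y, G.Adj z y → y ∈ insert x K := by
      rintro z (rfl | hz) hzx u hu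
      · exact absurd rfl hzx
      · by_cases huW : u ∈ W
        · left
          by_contra hux
          exact hcon z hz u huW hux hu
        · right
          obtain ⟨q, hq⟩ := hz
          refine ⟨q.concat hu, fun v hv => ?_⟩
          rw [Walk.support_concat, List.mem_append, List.mem_singleton] at hv
          rcases hv with hv | rfl
          · exact hq v hv
          · exact huW
    have key : ∀ {u v}, G.Adj u v → u ∈ insert x K := fun h =>
      hG.mem_of_adj x hU (Set.mem_insert _ _) (Set.mem_insert_of_mem _ hyK) hxy h
    have hK : ∀ u ∈ W, u ∈ insert x K → u = x := by
      rintro u hu (rfl | ⟨q, hq⟩)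
      · rfl
      · exact absurd hu (hq u (by simp))
    exact hcd.ne ((hK c hc (key hcd)).trans (hK d hd (key hcd.symm)).symm)
  obtain ⟨z, ⟨q, hq⟩, x', hx', hne, hzx'⟩ := this
  have hq' : ∀ v ∈ q.bypass.support, v ∉ W := fun v hv =>
    hq v (q.support_bypass_subset_support hv)
  have hp : HasPath G y z q.bypass.length {v | v ∈ q.bypass.support} :=
    ⟨q.bypass, q.bypass_isPath, rfl, fun _ => Iff.rfl⟩
  have h1 := (HasPath.of_adj hxy).append hp (by
    rintro v (rfl | rfl) hv
    · exact absurd hx (hq' _ hv)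
    · rfl)
  have h2 := h1.append (HasPath.of_adj hzx') (by
    rintro v ((rfl | rfl) | hv) (h | h)
    · exact h
    · exact absurd h hne.symm
    · exact h
    · exact absurd hx' (h ▸ hy)
    · exact h
    · exact absurd hx' (h ▸ hq' _ hv))
  refine ⟨x', hx', hne, _, _, by omega, h2, by simp, ?_⟩
  rintro v (((rfl | rfl) | hv) | (rfl | rfl)) hvW
  · exact Or.inl rfl
  · exact absurd hvW hy
  · exact absurd hvW (hq' _ hv)
  · exact absurd hvW (hq' _ (by simp))
  · exact Or.inr rfl

lemma exists_path_parity_or_odd_cycle {u v : V} (w : G.Walk u v) :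
    (∃ n A, HasPath G u v n A ∧ (Odd n ↔ Odd w.length)) ∨
      ∃ a b n A, G.Adj a b ∧ HasPath G a b n A ∧ Even n := by
  induction w with
  | nil => exact Or.inl ⟨_, _, ⟨Walk.nil, Walk.IsPath.nil, rfl, fun _ => Iff.rfl⟩, Iff.rfl⟩
  | @cons u c v h p ih =>
    rcases ih with ⟨n, A, hA, hn⟩ | ih
    · by_cases hu : u ∈ A
      · obtain ⟨n₁, n₂, A₁, A₂, h₁, h₂, rfl, -, -⟩ := hA.split hu
        by_cases he : Even n₁
        · exact Or.inr ⟨c, u, n₁, A₁, h.symm, h₁, he⟩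
        · refine Or.inl ⟨n₂, A₂, h₂, ?_⟩
          simp only [Walk.length_cons]
          grind
      · refine Or.inl ⟨_, _, (HasPath.of_adj h).append hA ?_, ?_⟩
        · rintro z (rfl | rfl) hz
          · exact absurd hz hu
          · rfl
        · simp only [Walk.length_cons]
          grind
    · exact Or.inr ih

lemma exists_odd_cycle_of_not_colorable (h : ¬ G.Colorable 2) :
    ∃ a b n A, G.Adj a b ∧ HasPath G a b n A ∧ Even n := by
  rw [two_colorable_iff_forall_loop_even] at h
  push Not at h
  obtain ⟨u, w, hw⟩ := h
  rcases exists_path_parity_or_odd_cycle w with ⟨n, A, ⟨p, hp, rfl, -⟩, hn⟩ | h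
  · obtain rfl := (Walk.isPath_iff_nil.1 hp).eq_nil
    simp at hn
    exact absurd hn hw
  · exact h

end Paths

/-- Two internally disjoint even `a`-`b` paths with vertex sets `P` and `Q`, closed up by the
edge `ab`. -/
structure IsEvenTheta {V : Type*} (G : SimpleGraph V) (a b : V) (P Q : Set V) (m n : ℕ) :
    Prop where
  adj : G.Adj a b
  left : HasPath G a b m P
  right : HasPath G a b n Q
  even_left : Even m
  even_right : Even n
  eq_or_eq : ∀ z, z ∈ P → z ∈ Q → z = a ∨ z = b

/-- `a, b, c, d` are pairwise adjacent. -/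
def IsK4 {V : Type*} (G : SimpleGraph V) (a b c d : V) : Prop :=
  G.Adj a b ∧ G.Adj a c ∧ G.Adj a d ∧ G.Adj b c ∧ G.Adj b d ∧ G.Adj c d

section Structure

variable {V : Type*} {G : SimpleGraph V} {a b x y v : V} {m n p q s p₁ p₂ p₃ q₁ q₂ : ℕ}
  {A P Q S P₁ P₂ P₃ Q₁ Q₂ : Set V}

lemma HasPath.eq_zero (h : HasPath G a a n A) : n = 0 := by
  obtain ⟨p, hp, rfl, -⟩ := h
  simp [(Walk.isPath_iff_nil.1 hp).eq_nil]

lemma HasPath.eq_of_zero (h : HasPath G a b 0 A) : a = b := by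
  obtain ⟨p, hp, hn, -⟩ := h
  exact Walk.eq_of_length_eq_zero hn

lemma HasPath.adj_of_one (h : HasPath G a b 1 A) : G.Adj a b := by
  obtain ⟨p, hp, hn, -⟩ := h
  exact Walk.adj_of_length_eq_one hn

lemma IsEvenTheta.symm (h : IsEvenTheta G a b P Q m n) : IsEvenTheta G b a P Q m n :=
  ⟨h.adj.symm, h.left.symm, h.right.symm, h.even_left, h.even_right,
    fun z h₁ h₂ => (h.eq_or_eq z h₁ h₂).symm⟩

lemma IsEvenTheta.swap (h : IsEvenTheta G a b P Q m n) : IsEvenTheta G a b Q P n m :=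
  ⟨h.adj, h.right, h.left, h.even_right, h.even_left, fun z h₁ h₂ => h.eq_or_eq z h₂ h₁⟩

lemma InGStar.cross_length (hG : InGStar G) (hab : G.Adj a b) (hP₁ : HasPath G a x p₁ P₁)
    (hQ₁ : HasPath G a y q₁ Q₁) (hQ₂ : HasPath G y b q₂ Q₂) (hS : HasPath G x y s S)
    (hPS : ∀ z, z ∈ P₁ → z ∈ S → z = x) (hPQ₁ : ∀ z, z ∈ P₁ → z ∈ Q₁ → z = a)
    (hPQ₂ : ∀ z, z ∈ P₁ → z ∉ Q₂) (hQ : ∀ z, z ∈ Q₁ → z ∈ Q₂ → z = y)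
    (hSQ₁ : ∀ z, z ∈ S → z ∈ Q₁ → z = y) (hSQ₂ : ∀ z, z ∈ S → z ∈ Q₂ → z = y)
    (hq : Even (q₁ + q₂)) (hxa : x ≠ a) (hya : y ≠ a) (hyb : y ≠ b) (hxy : x ≠ y) :
    q₁ = 1 ∧ Even (p₁ + s) := by
  have ha := hQ₁.left_mem
  have hb := hQ₂.right_mem
  have hp1 := hP₁.pos hxa.symm
  have hq1 := hQ₁.pos hya.symm
  have hq2 := hQ₂.pos hyb
  have hs1 := hS.pos hxy
  have hPS' := hP₁.append hS hPS
  have hR := (HasPath.of_adj hab).append hQ₂.symm (by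
    rintro z (rfl | rfl) hz
    · exact absurd (hQ _ ha hz).symm hya
    · rfl)
  have h1 : ∀ z, z ∈ Q₁ → z ∈ P₁ ∪ S → z = a ∨ z = y := by grind
  have h2 : ∀ z, z ∈ Q₁ → z ∈ {a, b} ∪ Q₂ → z = a ∨ z = y := by grind
  have h3 : ∀ z, z ∈ P₁ ∪ S → z ∈ {a, b} ∪ Q₂ → z = a ∨ z = y := by grind
  by_cases hpar : Even (p₁ + s + q₁)
  · have := hG.theta hya.symm hQ₁ hPS' hR h2 h3 h1 (by grind) (by grind) (by omega)
    omega
  · by_cases hq2' : 2 ≤ q₁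
    · have := hG.theta hya.symm hPS' hR hQ₁ (fun z h h' => h1 z h' h) (fun z h h' => h2 z h' h)
        h3 (by grind) (by grind) hq2'
      omega
    · exact ⟨by omega, by grind⟩

lemma IsEvenTheta.isK4 (h : IsEvenTheta G a b P Q m n) (hG : InGStar G) (hx : x ∈ P)
    (hxa : x ≠ a) (hxb : x ≠ b) (hy : y ∈ Q) (hya : y ≠ a) (hyb : y ≠ b)
    (hS : HasPath G x y s S) (hSP : ∀ z, z ∈ S → z ∈ P → z = x)
    (hSQ : ∀ z, z ∈ S → z ∈ Q → z = y) : IsK4 G a b x y := by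
  have hPQ := h.eq_or_eq
  have hxy : x ≠ y := by grind
  have hem := h.even_left
  have hen := h.even_right
  obtain ⟨p₁, p₂, P₁, P₂, hP₁, hP₂, rfl, hP, hP'⟩ := h.left.split hx
  obtain ⟨q₁, q₂, Q₁, Q₂, hQ₁, hQ₂, rfl, hQ, hQ'⟩ := h.right.split hy
  have ha := hP₁.left_mem
  have hb := hP₂.right_mem
  have ha' := hQ₁.left_mem
  have hb' := hQ₂.right_mem
  have e1 := hG.cross_length h.adj hP₁ hQ₁ hQ₂ hS (by grind) (by grind) (by grind) hQ' (by grind)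
    (by grind) hen hxa hya hyb hxy
  have e2 := hG.cross_length h.adj.symm hP₂.symm hQ₂.symm hQ₁.symm hS (by grind) (by grind)
    (by grind) (by grind) (by grind) (by grind) (by grind) hxb hyb hya hxy
  have e3 := hG.cross_length h.adj hQ₁ hP₁ hP₂ hS.symm (by grind) (by grind) (by grind) hP'
    (by grind) (by grind) hem hya hxa hxb hxy.symm
  have e4 := hG.cross_length h.adj.symm hQ₂.symm hP₂.symm hP₁.symm hS.symm (by grind) (by grind)
    (by grind) (by grind) (by grind) (by grind) (by grind) hyb hxb hxa hxy.symm
  have r1 := hP₁.symm.append hQ₁ (by grind)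
  have r2 := hP₂.append hQ₂.symm (by grind)
  have hs : s = 1 := by
    have := hS.pos hxy
    by_contra hs
    have := hG.theta hxy r1 r2 hS (by grind) (by grind) (by grind) (by grind) (by grind)
      (by omega)
    omega
  obtain ⟨rfl, -⟩ := e1
  obtain ⟨rfl, -⟩ := e2
  obtain ⟨rfl, -⟩ := e3
  obtain ⟨rfl, -⟩ := e4
  subst hs
  exact ⟨h.adj, hP₁.adj_of_one, hQ₁.adj_of_one, hP₂.adj_of_one.symm, hQ₂.adj_of_one.symm,
    hS.adj_of_one⟩

lemma IsEvenTheta.chord (hG : InGStar G) (hab : G.Adj a b) (hP₁ : HasPath G a x p₁ P₁)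
    (hP₂ : HasPath G x y p₂ P₂) (hP₃ : HasPath G y b p₃ P₃) (hQ : HasPath G a b q Q)
    (hS : HasPath G x y s S) (h₁₂ : ∀ z, z ∈ P₁ → z ∈ P₂ → z = x)
    (h₁₃ : ∀ z, z ∈ P₁ → z ∉ P₃) (h₂₃ : ∀ z, z ∈ P₂ → z ∈ P₃ → z = y)
    (hPQ : ∀ z, z ∈ P₁ ∨ z ∈ P₂ ∨ z ∈ P₃ → z ∈ Q → z = a ∨ z = b)
    (hSP : ∀ z, z ∈ S → z ∈ P₁ ∨ z ∈ P₂ ∨ z ∈ P₃ → z = x ∨ z = y)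
    (hSQ : ∀ z, z ∈ S → z ∈ Q → z = a ∨ z = b)
    (hp : Even (p₁ + p₂ + p₃)) (hq : Even q) (hxa : x ≠ a) (hxy : x ≠ y) :
    p₂ = 1 ∧ s = 1 := by
  have hp1 := hP₁.pos hxa.symm
  have hs1 := hS.pos hxy
  have hq1 := hQ.pos hab.ne
  have ha := hP₁.left_mem
  have hb := hP₃.right_mem
  have hx := hP₁.right_mem
  have hx2 := hP₂.left_mem
  have hy := hP₃.left_mem
  have hR := (hP₁.symm.append (HasPath.of_adj hab) (by grind)).append hP₃.symm (by grind)
  by_cases hpar : Even (s + p₂)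
  · exact hG.theta hxy hP₂ hS hR (by grind) (by grind) (by grind) (by grind) (by grind)
      (by omega)
  · have hP' := (hP₁.append hS (by grind)).append hP₃ (by grind)
    have := hG.theta hab.ne (HasPath.of_adj hab) hP' hQ (by grind) (by grind) (by grind)
      (by grind) (by grind) (by grind)
    omega

lemma IsEvenTheta.eq_of_ear (h : IsEvenTheta G a b P Q m n) (hG : InGStar G)
    (hP₁ : HasPath G a x p₁ P₁) (hxv : G.Adj x v) (hP₂ : HasPath G v b p₂ P₂)
    (hm : m = p₁ + (1 + p₂)) (hP : ∀ z, z ∈ P ↔ z ∈ P₁ ∨ z ∈ P₂) (h₁₂ : ∀ z, z ∈ P₁ → z ∉ P₂)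
    (hxa : x ≠ a) (hy : y ∈ P₂) (hS : HasPath G x y s S)
    (hSP : ∀ z, z ∈ S → z ∈ P → z = x ∨ z = y) (hSQ : ∀ z, z ∈ S → z ∈ Q → z = a ∨ z = b) :
    y = v ∧ s = 1 := by
  obtain ⟨r₁, r₂, R₁, R₂, hR₁, hR₂, rfl, hR, hR'⟩ := hP₂.split hy
  have hx := hP₁.right_mem
  have hv := hR₁.left_mem
  have hy' := hR₁.right_mem
  have hPQ := h.eq_or_eq
  have key := IsEvenTheta.chord hG h.adj hP₁ ((HasPath.of_adj hxv).append hR₁ (by grind)) hR₂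
    h.right hS (by grind) (by grind) (by grind) (by grind) (by grind) hSQ
    (by have := h.even_left; grind) h.even_right hxa (by grind)
  obtain rfl : r₁ = 0 := by omega
  exact ⟨hR₁.eq_of_zero.symm, key.2⟩

/-- Without `K₄`, the inner vertices of an even theta have degree two. -/
lemma IsEvenTheta.exists_pair (h : IsEvenTheta G a b P Q m n) (hG : InGStar G)
    (hN : Nonseparable G) (hK : ∀ a b c d, ¬ IsK4 G a b c d) (hx : x ∈ P) (hxa : x ≠ a)
    (hxb : x ≠ b) : ∃ u ∈ P, ∃ v ∈ P, ∀ y, G.Adj x y → y = u ∨ y = v := by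
  obtain ⟨p₁, p₂, P₁, P₂, hP₁, hP₂, rfl, hP, hP'⟩ := h.left.split hx
  obtain ⟨v, P₂', hv, hP₂', hxP₂, hPP₂⟩ := hP₂.uncons hxb
  obtain ⟨u, P₁', hu, hP₁', hxP₁, hPP₁⟩ := hP₁.symm.uncons hxa
  have hp₁ := hP₁.pos hxa.symm
  have hp₂ := hP₂.pos hxb
  have hv' := hP₂'.left_mem
  have hu' := hP₁'.left_mem
  have ha := h.left.left_mem
  have hb := h.left.right_mem
  have ha' := h.right.left_mem
  have hb' := h.right.right_mem
  have hPQ := h.eq_or_eq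
  refine ⟨u, by grind, v, by grind, ?_⟩
  by_contra! hcon
  obtain ⟨y, hxy, hyu, hyv⟩ := hcon
  have hne := hxy.ne
  obtain ⟨x', hx', hne', s, S, hS, hSW, hs⟩ : ∃ x', (x' ∈ P ∨ x' ∈ Q) ∧ x' ≠ x ∧ ∃ s S,
      HasPath G x x' s S ∧ (∀ z, z ∈ S → z ∈ P ∨ z ∈ Q → z = x ∨ z = x') ∧
        (s = 1 → x' = y) := by
    by_cases hy : y ∈ P ∨ y ∈ Q
    · exact ⟨y, hy, hxy.ne', 1, _, HasPath.of_adj hxy, by simp, by simp⟩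
    · obtain ⟨x', hx', hne', s, S, hs, hS, -, hSW⟩ :=
        hN.exists_ear (W := P ∪ Q) (Or.inl hx) hy hxy (Or.inl ha) (Or.inl hb) h.adj
      exact ⟨x', hx', hne', s, S, hS, hSW, by omega⟩
  by_cases hx'P : x' ∈ P
  · rcases (hP x').1 hx'P with h1 | h1
    · have := h.symm.eq_of_ear hG hP₂.symm hu hP₁' (by omega) (by grind) (by grind) hxb
        (by grind) hS (by grind) (by grind)
      grind
    · have := h.eq_of_ear hG hP₁ hv hP₂' (by omega) (by grind) (by grind) hxa
        (by grind) hS (by grind) (by grind)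
      grind
  · exact hK _ _ _ _ (h.isK4 hG hx hxa hxb (hx'.resolve_left hx'P) (by grind) (by grind) hS
      (by grind) (by grind))

end Structure

section Structure

variable {V : Type*} {G : SimpleGraph V} {a b c d x y v : V} {m n p q s : ℕ}
  {A P Q S : Set V}

lemma IsK4.not_ear (h : IsK4 G a b c d) (hG : InGStar G) (hS : HasPath G a b s S) (hs : 2 ≤ s)
    (hc : c ∉ S) (hd : d ∉ S) : False := by
  obtain ⟨hab, hac, had, hbc, hbd, hcd⟩ := h
  have e1 := hab.ne
  have e2 := hac.ne
  have e3 := had.ne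
  have e4 := hbc.ne
  have e5 := hbd.ne
  have e6 := hcd.ne
  have hQ := (HasPath.of_adj hac).append (HasPath.of_adj hbc.symm) (by grind)
  have hR := ((HasPath.of_adj hac).append (HasPath.of_adj hcd) (by grind)).append
    (HasPath.of_adj hbd.symm) (by grind)
  by_cases hse : Even s
  · have := hG.theta hab.ne (HasPath.of_adj hab) hR hS (by grind) (by grind) (by grind)
      (by grind) (by grind) hs
    omega
  · have := hG.theta hab.ne (HasPath.of_adj hab) hS hQ (by grind) (by grind) (by grind)
      (by grind) (by grind) (by omega)
    omega

/-- A nonseparable graph of `G*` containing `K₄` has no other edges. -/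
lemma IsK4.mem_of_adj (h : IsK4 G a b c d) (hG : InGStar G) (hN : Nonseparable G)
    (hxy : G.Adj x y) : x ∈ ({a, b, c, d} : Set V) := by
  refine hN.mem_of_adj (U := {a, b, c, d}) a ?_ (a := a) (b := b) (by simp) (by simp) h.1 hxy
  intro u hu _ y huy
  by_contra hy
  obtain ⟨u', hu', hne, s, S, hs, hS, -, hW⟩ :=
    hN.exists_ear hu hy huy (c := a) (d := b) (by simp) (by simp) h.1
  have e1 := h.1.ne
  have e2 := h.2.1.ne
  have e3 := h.2.2.1.ne
  have e4 := h.2.2.2.1.ne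
  have e5 := h.2.2.2.2.1.ne
  have e6 := h.2.2.2.2.2.ne
  have hc : ∀ z, z ≠ u → z ≠ u' → z ∈ ({a, b, c, d} : Set V) → z ∉ S := by grind
  obtain ⟨c', d', hK, h1, h2, h3, h4⟩ : ∃ c' d', IsK4 G u u' c' d' ∧ (c' ≠ u ∧ c' ≠ u') ∧
      (d' ≠ u ∧ d' ≠ u') ∧ c' ∈ ({a, b, c, d} : Set V) ∧ d' ∈ ({a, b, c, d} : Set V) := by
    obtain ⟨hab, hac, had, hbc, hbd, hcd⟩ := h
    simp only [Set.mem_insert_iff, Set.mem_singleton_iff] at hu hu'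
    rcases hu with rfl | rfl | rfl | rfl <;> rcases hu' with rfl | rfl | rfl | rfl <;>
      first
        | exact absurd rfl hne
        | exact ⟨_, _, ⟨hab, hac, had, hbc, hbd, hcd⟩, by grind⟩
        | exact ⟨_, _, ⟨hac, hab, had, hbc.symm, hcd, hbd⟩, by grind⟩
        | exact ⟨_, _, ⟨had, hab, hac, hbd.symm, hcd.symm, hbc⟩, by grind⟩
        | exact ⟨_, _, ⟨hab.symm, hbc, hbd, hac, had, hcd⟩, by grind⟩
        | exact ⟨_, _, ⟨hbc, hab.symm, hbd, hac.symm, hcd, had⟩, by grind⟩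
        | exact ⟨_, _, ⟨hbd, hab.symm, hbc, had.symm, hcd.symm, hac⟩, by grind⟩
        | exact ⟨_, _, ⟨hac.symm, hbc.symm, hcd, hab, had, hbd⟩, by grind⟩
        | exact ⟨_, _, ⟨hbc.symm, hac.symm, hcd, hab.symm, hbd, had⟩, by grind⟩
        | exact ⟨_, _, ⟨hcd, hac.symm, hbc.symm, had.symm, hbd.symm, hab⟩, by grind⟩
        | exact ⟨_, _, ⟨had.symm, hbd.symm, hcd.symm, hab, hac, hbc⟩, by grind⟩
        | exact ⟨_, _, ⟨hbd.symm, had.symm, hcd.symm, hab.symm, hbc, hac⟩, by grind⟩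
        | exact ⟨_, _, ⟨hcd.symm, had.symm, hbd.symm, hac.symm, hbc.symm, hab⟩, by grind⟩
  exact hK.not_ear hG hS hs (hc _ h1.1 h1.2 h3) (hc _ h2.1 h2.2 h4)

/-- A nonseparable `K₄`-free graph of `G*` with an even theta is a book: off the hubs all degrees
are at most two. -/
lemma IsEvenTheta.book (h : IsEvenTheta G a b P Q m n) (hG : InGStar G)
    (hN : Nonseparable G) (hK : ∀ a b c d, ¬ IsK4 G a b c d) (hxa : x ≠ a) (hxb : x ≠ b) :
    ∃ u v, ∀ y, G.Adj x y → y = u ∨ y = v := by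
  let U : Set V := {v | v = a ∨ v = b ∨ ∃ P m Q n, IsEvenTheta G a b P Q m n ∧ v ∈ P}
  have aux : ∀ a b x y P Q m n, (x = a) → IsEvenTheta G a b P Q m n → G.Adj x y → y ∉ P ∪ Q →
      ∃ P m Q n, IsEvenTheta G a b P Q m n ∧ y ∈ P := by
    rintro a b x y P Q m n rfl h hxy hy
    have hPQ := h.eq_or_eq
    have ha := h.left.left_mem
    have hb := h.left.right_mem
    have ha' := h.right.left_mem
    have hb' := h.right.right_mem
    obtain ⟨x', hx', hne', s, S, hs, hS, hyS, hSW⟩ :=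
        hN.exists_ear (W := P ∪ Q) (Or.inl ha) hy hxy (Or.inl ha) (Or.inl hb) h.adj
    have hx'b : x' = b := by
      by_contra hx'b
      obtain ⟨u, S', hu, hS', hx'S', hSS'⟩ := hS.symm.uncons hne'
      have huS := hS'.left_mem
      have hux : u = x → s = 1 := by
        rintro rfl
        have := hS'.eq_zero
        omega
      have hux' : u ≠ x := by rintro rfl; have := hux rfl; omega
      have huPQ : u ∉ P ∪ Q := by
        have := hu.ne
        grind
      have : ∃ p ∈ P ∪ Q, ∃ q ∈ P ∪ Q, ∀ y, G.Adj x' y → y = p ∨ y = q := by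
        rcases hx' with hx' | hx'
        · obtain ⟨p, hp, q, hq, h⟩ := h.exists_pair hG hN hK hx' hne' hx'b
          exact ⟨p, Or.inl hp, q, Or.inl hq, h⟩
        · obtain ⟨p, hp, q, hq, h⟩ := h.swap.exists_pair hG hN hK hx' hne' hx'b
          exact ⟨p, Or.inr hp, q, Or.inr hq, h⟩
      obtain ⟨p, hp, q, hq, hpq⟩ := this
      rcases hpq u hu with rfl | rfl
      · exact huPQ hp
      · exact huPQ hq
    subst hx'b
    have hse : Even s := by
      by_contra hso
      have hq := h.right.pos h.adj.ne
      have hev := h.even_right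
      have := hG.theta h.adj.ne (HasPath.of_adj h.adj) hS h.right (by grind) (by grind) (by grind)
        (by grind) (by grind) (by grind)
      omega
    exact ⟨S, s, Q, n, ⟨h.adj, hS, h.right, hse, h.even_right, by grind⟩, hyS⟩
  have hU : ∀ x ∈ U, ∀ y, G.Adj x y → y ∈ U := by
    intro x hx y hxy
    by_cases hxa : x = a
    · by_cases hy : y ∈ P ∪ Q
      · rcases hy with hy | hy
        · exact Or.inr (Or.inr ⟨_, _, _, _, h, hy⟩)
        · exact Or.inr (Or.inr ⟨_, _, _, _, h.swap, hy⟩)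
      · exact Or.inr (Or.inr (aux _ _ _ _ _ _ _ _ hxa h hxy hy))
    by_cases hxb : x = b
    · by_cases hy : y ∈ P ∪ Q
      · rcases hy with hy | hy
        · exact Or.inr (Or.inr ⟨_, _, _, _, h, hy⟩)
        · exact Or.inr (Or.inr ⟨_, _, _, _, h.swap, hy⟩)
      · obtain ⟨P', m', Q', n', h', hy'⟩ := aux _ _ _ _ _ _ _ _ hxb h.symm hxy hy
        exact Or.inr (Or.inr ⟨_, _, _, _, h'.symm, hy'⟩)
    obtain ⟨P', m', Q', n', h', hx'⟩ := (hx.resolve_left hxa).resolve_left hxb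
    obtain ⟨u, hu, v, hv, huv⟩ := h'.exists_pair hG hN hK hx' hxa hxb
    rcases huv y hxy with rfl | rfl
    · exact Or.inr (Or.inr ⟨_, _, _, _, h', hu⟩)
    · exact Or.inr (Or.inr ⟨_, _, _, _, h', hv⟩)
  by_cases hx : x ∈ U
  · obtain ⟨P', m', Q', n', h', hx'⟩ := (hx.resolve_left hxa).resolve_left hxb
    obtain ⟨u, -, v, -, huv⟩ := h'.exists_pair hG hN hK hx' hxa hxb
    exact ⟨u, v, huv⟩
  · refine ⟨a, a, fun y hxy => absurd ?_ hx⟩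
    exact hN.mem_of_adj (U := U) a (fun x hx _ => hU x hx) (a := a) (b := b) (Or.inl rfl)
      (Or.inr (Or.inl rfl)) h.adj hxy
end Structure

section Structure

variable {V : Type*} {G : SimpleGraph V} {a b c d x y v : V} {m n p q s p₁ p₂ p₃ : ℕ}
  {A P Q S P₁ P₂ P₃ : Set V}

lemma InGStar.cycle_ear (hG : InGStar G) (hE : ∀ a b P Q m n, ¬ IsEvenTheta G a b P Q m n)
    (hab : G.Adj a b) (hP₁ : HasPath G a x p₁ P₁) (hP₂ : HasPath G x y p₂ P₂)
    (hP₃ : HasPath G y b p₃ P₃) (hS : HasPath G x y s S) (h₁₂ : ∀ z, z ∈ P₁ → z ∈ P₂ → z = x)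
    (h₁₃ : ∀ z, z ∈ P₁ → z ∉ P₃) (h₂₃ : ∀ z, z ∈ P₂ → z ∈ P₃ → z = y)
    (hSP : ∀ z, z ∈ S → z ∈ P₁ ∨ z ∈ P₂ ∨ z ∈ P₃ → z = x ∨ z = y)
    (hp : Even (p₁ + p₂ + p₃)) (hxy : x ≠ y) : s = 1 ∧ (p₂ = 1 ∨ p₁ = 0 ∧ p₃ = 0) := by
  have hs1 := hS.pos hxy
  have hp2 := hP₂.pos hxy
  have ha := hP₁.left_mem
  have hb := hP₃.right_mem
  have hx := hP₁.right_mem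
  have hx2 := hP₂.left_mem
  have hy := hP₃.left_mem
  have hR := (hP₁.symm.append (HasPath.of_adj hab) (by grind)).append hP₃.symm (by grind)
  by_cases hpar : Even (s + p₂)
  · by_cases hr : 2 ≤ p₁ + 1 + p₃
    · have := hG.theta hxy hP₂ hS hR (by grind) (by grind) (by grind) (by grind) (by grind) hr
      omega
    · obtain rfl : p₁ = 0 := by omega
      obtain rfl : p₃ = 0 := by omega
      obtain rfl := hP₁.eq_of_zero
      obtain rfl := hP₃.eq_of_zero
      exact absurd ⟨hab, hP₂, hS, by grind, by grind, by grind⟩ (hE a y P₂ S p₂ s)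
  · by_cases hp2' : 2 ≤ p₂
    · have := hG.theta hxy hR hS hP₂ (by grind) (by grind) (by grind) (by grind) (by grind) hp2'
      omega
    · obtain rfl : p₂ = 1 := by omega
      exact absurd ⟨hP₂.adj_of_one, hR, hS, by grind, by grind, by grind⟩
        (hE x y _ S _ s)

/-- A nonseparable graph of `G*` containing an odd cycle but no even theta is that cycle. -/
lemma InGStar.book_of_cycle (hG : InGStar G) (hN : Nonseparable G)
    (hE : ∀ a b P Q m n, ¬ IsEvenTheta G a b P Q m n) (hab : G.Adj a b)
    (hA : HasPath G a b n A) (hn : Even n) (hxa : x ≠ a) (hxb : x ≠ b) :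
    ∃ u v, ∀ y, G.Adj x y → y = u ∨ y = v := by
  have ha := hA.left_mem
  have hb := hA.right_mem
  have aux : ∀ x ∈ A, ∀ y ∈ A, x ≠ y → ∀ s S, HasPath G x y s S →
      (∀ z, z ∈ S → z ∈ A → z = x ∨ z = y) → s = 1 := by
    intro x hx y hy hxy s S hS hSA
    obtain ⟨p₁, p₂, P₁, P₂, hP₁, hP₂, rfl, hP, hP'⟩ := hA.split hx
    have hx₁ := hP₁.right_mem
    have hx₂ := hP₂.left_mem
    rcases (hP y).1 hy with h | h
    · obtain ⟨q₁, q₂, Q₁, Q₂, hQ₁, hQ₂, rfl, hQ, hQ'⟩ := hP₁.split h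
      have := hQ₁.right_mem
      have := hQ₂.right_mem
      exact (hG.cycle_ear hE hab hQ₁ hQ₂ hP₂ hS.symm (by grind) (by grind) (by grind) (by grind)
        (by grind) hxy.symm).1
    · obtain ⟨q₁, q₂, Q₁, Q₂, hQ₁, hQ₂, rfl, hQ, hQ'⟩ := hP₂.split h
      have := hQ₂.left_mem
      have := hQ₁.left_mem
      exact (hG.cycle_ear hE hab hP₁ hQ₁ hQ₂ hS (by grind) (by grind) (by grind) (by grind)
        (by grind) hxy).1
  have hU : ∀ x ∈ A, ∀ y, G.Adj x y → y ∈ A := by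
    intro x hx y hxy
    by_contra hy
    obtain ⟨x', hx', hne', s, S, hs, hS, hyS, hSW⟩ := hN.exists_ear hx hy hxy ha hb hab
    have := aux x hx x' hx' hne'.symm s S hS hSW
    omega
  by_cases hx : x ∈ A
  · obtain ⟨p₁, p₂, P₁, P₂, hP₁, hP₂, rfl, hP, hP'⟩ := hA.split hx
    obtain ⟨v, P₂', hv, hP₂', hxP₂, hPP₂⟩ := hP₂.uncons hxb
    obtain ⟨u, P₁', hu, hP₁', hxP₁, hPP₁⟩ := hP₁.symm.uncons hxa
    have hp₁ := hP₁.pos hxa.symm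
    have hp₂ := hP₂.pos hxb
    have hv' := hP₂'.left_mem
    have hu' := hP₁'.left_mem
    refine ⟨u, v, fun y hxy => ?_⟩
    have hne := hxy.ne
    have hyA := hU x hx y hxy
    rcases (hP y).1 hyA with h | h
    · have h' : y ∈ P₁' := by grind
      obtain ⟨q₁, q₂, Q₁, Q₂, hQ₁, hQ₂, he, hQ, hQ'⟩ := hP₁'.split h'
      have hq := hQ₁.left_mem
      have hq' := hQ₁.right_mem
      have := (hG.cycle_ear hE hab.symm hP₂.symm ((HasPath.of_adj hu).append hQ₁ (by grind)) hQ₂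
        (HasPath.of_adj hxy) (by grind) (by grind) (by grind) (by grind) (by grind) hne).2
      obtain rfl : q₁ = 0 := by omega
      exact Or.inl hQ₁.eq_of_zero.symm
    · have h' : y ∈ P₂' := by grind
      obtain ⟨q₁, q₂, Q₁, Q₂, hQ₁, hQ₂, he, hQ, hQ'⟩ := hP₂'.split h'
      have hq := hQ₁.left_mem
      have hq' := hQ₁.right_mem
      have := (hG.cycle_ear hE hab hP₁ ((HasPath.of_adj hv).append hQ₁ (by grind)) hQ₂
        (HasPath.of_adj hxy) (by grind) (by grind) (by grind) (by grind) (by grind) hne).2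
      obtain rfl : q₁ = 0 := by omega
      exact Or.inr hQ₁.eq_of_zero.symm
  · refine ⟨a, a, fun y hxy => absurd ?_ hx⟩
    exact hN.mem_of_adj (U := A) a (fun x hx _ => hU x hx) ha hb hab hxy

/-- The nonbipartite nonseparable graphs of `G*`. -/
theorem InGStar.exists_isK4_or_book (hG : InGStar G) (hN : Nonseparable G) (h2 : ¬ G.Colorable 2) :
    (∃ a b c d, IsK4 G a b c d ∧ ∀ x y, G.Adj x y → x ∈ ({a, b, c, d} : Set V)) ∨
      ∃ a b, G.Adj a b ∧ ∀ x, x ≠ a → x ≠ b → ∃ u v, ∀ y, G.Adj x y → y = u ∨ y = v := by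
  by_cases hK : ∃ a b c d, IsK4 G a b c d
  · obtain ⟨a, b, c, d, h⟩ := hK
    exact Or.inl ⟨a, b, c, d, h, fun x y hxy => h.mem_of_adj hG hN hxy⟩
  push Not at hK
  right
  by_cases hE : ∃ a b P Q m n, IsEvenTheta G a b P Q m n
  · obtain ⟨a, b, P, Q, m, n, h⟩ := hE
    exact ⟨a, b, h.adj, fun x hxa hxb => h.book hG hN hK hxa hxb⟩
  · push Not at hE
    obtain ⟨a, b, n, A, hab, hA, hn⟩ := exists_odd_cycle_of_not_colorable h2
    exact ⟨a, b, hab, fun x hxa hxb => hG.book_of_cycle hN hE hab hA hn hxa hxb⟩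

end Structure

section Galvin

variable {X Y : Type*} {E : Finset (X × Y)} {c : X × Y → ℕ}

/-- Gale-Shapley, for rows preferring large and columns preferring small values of `c`. -/
lemma exists_stable_matching (E : Finset (X × Y)) (c : X × Y → ℕ)
    (hr : ∀ e ∈ E, ∀ f ∈ E, e.1 = f.1 → c e = c f → e = f)
    (hc : ∀ e ∈ E, ∀ f ∈ E, e.2 = f.2 → c e = c f → e = f) :
    ∃ M ⊆ E, (∀ e ∈ M, ∀ f ∈ M, e.1 = f.1 ∨ e.2 = f.2 → e = f) ∧
      ∀ e ∈ E, e ∉ M → (∃ f ∈ M, f.1 = e.1 ∧ c e < c f) ∨ ∃ f ∈ M, f.2 = e.2 ∧ c f < c e := by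
  classical
  induction E using Finset.strongInduction with
  | H E ih =>
    by_cases hB : ∃ e ∈ E, ∃ f ∈ E, e.2 = f.2 ∧ c e < c f ∧
        (∀ g ∈ E, g.1 = e.1 → c g ≤ c e) ∧ ∀ g ∈ E, g.1 = f.1 → c g ≤ c f
    · obtain ⟨e, he, f, hf, hef, hlt, hbe, hbf⟩ := hB
      obtain ⟨M, hM, hmat, hdom⟩ := ih (E.erase f) (Finset.erase_ssubset hf)
        (fun a ha b hb => hr a (Finset.mem_of_mem_erase ha) b (Finset.mem_of_mem_erase hb))
        (fun a ha b hb => hc a (Finset.mem_of_mem_erase ha) b (Finset.mem_of_mem_erase hb))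
      refine ⟨M, hM.trans (Finset.erase_subset _ _), hmat, ?_⟩
      intro g hg hgM
      by_cases hgf : g = f
      · subst hgf
        right
        by_cases heM : e ∈ M
        · exact ⟨e, heM, hef, hlt⟩
        · have hef' : e ≠ g := by rintro rfl; exact lt_irrefl _ hlt
          rcases hdom e (Finset.mem_erase.2 ⟨hef', he⟩) heM with ⟨h, hh, h1, h2⟩ | ⟨h, hh, h1, h2⟩
          · exact absurd (hbe h (Finset.mem_of_mem_erase (hM hh)) h1) (by omega)
          · exact ⟨h, hh, h1.trans hef, h2.trans hlt⟩
      · exact hdom g (Finset.mem_erase.2 ⟨hgf, hg⟩) hgM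
    · push Not at hB
      refine ⟨E.filter fun e => ∀ g ∈ E, g.1 = e.1 → c g ≤ c e, Finset.filter_subset _ _, ?_, ?_⟩
      · intro e he f hf hef
        obtain ⟨he, hbe⟩ := Finset.mem_filter.1 he
        obtain ⟨hf, hbf⟩ := Finset.mem_filter.1 hf
        rcases hef with hef | hef
        · exact hr e he f hf hef (le_antisymm (hbf e he hef) (hbe f hf hef.symm))
        · refine hc e he f hf hef ?_
          by_contra hne
          rcases lt_or_gt_of_ne hne with h | h
          · obtain ⟨g, hg, hgf, hlt⟩ := hB e he f hf hef h hbe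
            exact absurd (hbf g hg hgf) (by omega)
          · obtain ⟨g, hg, hgf, hlt⟩ := hB f hf e he hef.symm h hbf
            exact absurd (hbe g hg hgf) (by omega)
      · intro e he hne
        left
        obtain ⟨f, hf, hmax⟩ := (E.filter fun g => g.1 = e.1).exists_max_image c
          ⟨e, Finset.mem_filter.2 ⟨he, rfl⟩⟩
        obtain ⟨hf, hfe⟩ := Finset.mem_filter.1 hf
        have hfB : ∀ g ∈ E, g.1 = f.1 → c g ≤ c f := fun g hg hgf =>
          hmax g (Finset.mem_filter.2 ⟨hg, hgf.trans hfe⟩)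
        refine ⟨f, Finset.mem_filter.2 ⟨hf, hfB⟩, hfe, ?_⟩
        refine lt_of_le_of_ne (hfB e he hfe.symm) fun h => hne ?_
        obtain rfl := hr e he f hf hfe.symm h
        exact Finset.mem_filter.2 ⟨hf, hfB⟩

/-- Galvin's list colouring of the line graph of a bipartite graph. -/
lemma exists_list_coloring_of_card_lt (E : Finset (X × Y)) (c : X × Y → ℕ)
    (L : X × Y → Finset ℕ)
    (hr : ∀ e ∈ E, ∀ f ∈ E, e.1 = f.1 → c e = c f → e = f)
    (hc : ∀ e ∈ E, ∀ f ∈ E, e.2 = f.2 → c e = c f → e = f)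
    (hL : ∀ e ∈ E, {f ∈ (E : Set (X × Y)) | (f.1 = e.1 ∧ c e < c f) ∨
      (f.2 = e.2 ∧ c f < c e)}.ncard < (L e).card) :
    ∃ φ : X × Y → ℕ, (∀ e ∈ E, φ e ∈ L e) ∧
      ∀ e ∈ E, ∀ f ∈ E, e ≠ f → e.1 = f.1 ∨ e.2 = f.2 → φ e ≠ φ f := by
  classical
  induction E using Finset.strongInduction generalizing L with
  | H E ih =>
    rcases E.eq_empty_or_nonempty with rfl | ⟨e₀, he₀⟩
    · exact ⟨fun _ => 0, by simp, by simp⟩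
    obtain ⟨t, ht⟩ : (L e₀).Nonempty := Finset.card_pos.1 (by have := hL e₀ he₀; omega)
    obtain ⟨M, hM, hmat, hdom⟩ := exists_stable_matching (E.filter fun e => t ∈ L e) c
      (fun e he f hf => hr e (Finset.mem_of_mem_filter _ he) f (Finset.mem_of_mem_filter _ hf))
      (fun e he f hf => hc e (Finset.mem_of_mem_filter _ he) f (Finset.mem_of_mem_filter _ hf))
    have hME : M ⊆ E := hM.trans (Finset.filter_subset _ _)
    have hMne : M.Nonempty := by
      by_cases h : e₀ ∈ M
      · exact ⟨_, h⟩
      · rcases hdom e₀ (Finset.mem_filter.2 ⟨he₀, ht⟩) h with ⟨f, hf, -⟩ | ⟨f, hf, -⟩ <;>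
          exact ⟨f, hf⟩
    obtain ⟨φ, hφ, hφ'⟩ := ih (E \ M) (Finset.sdiff_ssubset hME hMne) (fun e => (L e).erase t)
      (fun e he f hf => hr e (Finset.sdiff_subset he) f (Finset.sdiff_subset hf))
      (fun e he f hf => hc e (Finset.sdiff_subset he) f (Finset.sdiff_subset hf)) (by
        intro e he
        obtain ⟨heE, heM⟩ := Finset.mem_sdiff.1 he
        have hfin : {f ∈ (E : Set (X × Y)) | (f.1 = e.1 ∧ c e < c f) ∨
          (f.2 = e.2 ∧ c f < c e)}.Finite := E.finite_toSet.subset fun f hf => hf.1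
        by_cases hte : t ∈ L e
        · have hlt : {f ∈ ((E \ M : Finset (X × Y)) : Set (X × Y)) |
              (f.1 = e.1 ∧ c e < c f) ∨ (f.2 = e.2 ∧ c f < c e)}.ncard <
              {f ∈ (E : Set (X × Y)) | (f.1 = e.1 ∧ c e < c f) ∨
                (f.2 = e.2 ∧ c f < c e)}.ncard := by
            refine Set.ncard_lt_ncard ?_ hfin
            refine ⟨fun f hf => ⟨(Finset.mem_sdiff.1 hf.1).1, hf.2⟩, fun hsub => ?_⟩
            rcases hdom e (Finset.mem_filter.2 ⟨heE, hte⟩) heM with ⟨f, hf, h⟩ | ⟨f, hf, h⟩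
            · exact (Finset.mem_sdiff.1 (hsub ⟨hME hf, Or.inl h⟩).1).2 hf
            · exact (Finset.mem_sdiff.1 (hsub ⟨hME hf, Or.inr h⟩).1).2 hf
          have := hL e heE
          rw [Finset.card_erase_of_mem hte]
          omega
        · rw [Finset.erase_eq_of_notMem hte]
          refine (Set.ncard_le_ncard ?_ hfin).trans_lt (hL e heE)
          exact fun f hf => ⟨(Finset.mem_sdiff.1 hf.1).1, hf.2⟩)
    refine ⟨fun e => if e ∈ M then t else φ e, ?_, ?_⟩
    · intro e he
      by_cases heM : e ∈ M
      · simpa [heM] using (Finset.mem_filter.1 (hM heM)).2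
      · simpa [heM] using Finset.mem_of_mem_erase (hφ e (Finset.mem_sdiff.2 ⟨he, heM⟩))
    · intro e he f hf hne hef
      have key : ∀ e ∈ E, e ∉ M → φ e ≠ t := fun e he heM =>
        Finset.ne_of_mem_erase (hφ e (Finset.mem_sdiff.2 ⟨he, heM⟩))
      by_cases heM : e ∈ M <;> by_cases hfM : f ∈ M
      · exact absurd (hmat e heM f hfM hef) hne
      · simpa [heM, hfM] using (key f hf hfM).symm
      · simpa [heM, hfM] using key e he heM
      · simpa [heM, hfM] using hφ' e (Finset.mem_sdiff.2 ⟨he, heM⟩) f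
          (Finset.mem_sdiff.2 ⟨hf, hfM⟩) hne hef

/-- A square matrix of natural numbers with constant line sums is a sum of permutation
matrices. -/
lemma exists_perm_of_line_sums {V : Type*} [Fintype V] [DecidableEq V] (k : ℕ)
    (M : V → V → ℕ) (hrow : ∀ x, ∑ y, M x y = k) (hcol : ∀ y, ∑ x, M x y = k) :
    ∃ σ : Fin k → Equiv.Perm V, ∀ x y, M x y = (Finset.univ.filter fun t => σ t x = y).card := by
  induction k generalizing M with
  | zero =>
    refine ⟨Fin.elim0, fun x y => ?_⟩
    have := hrow x
    rw [Finset.sum_eq_zero_iff] at this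
    simp [this y]
  | succ k ih =>
    obtain ⟨τ, hτ⟩ : ∃ τ : Equiv.Perm V, ∀ x, 0 < M x (τ x) := by
      have hH : ∀ S : Finset V, S.card ≤ (S.biUnion fun x => Finset.univ.filter
          fun y => 0 < M x y).card := by
        intro S
        set T := S.biUnion fun x => Finset.univ.filter fun y => 0 < M x y with hT
        have h1 : S.card * (k + 1) = ∑ x ∈ S, ∑ y ∈ T, M x y := by
          rw [Finset.sum_const_nat (m := k + 1)]
          intro x hx
          rw [← hrow x]
          refine Finset.sum_subset (Finset.subset_univ _) fun y _ hy => ?_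
          by_contra h
          exact hy (Finset.mem_biUnion.2 ⟨x, hx, by simp; omega⟩)
        have h2 : ∑ x ∈ S, ∑ y ∈ T, M x y ≤ T.card * (k + 1) := by
          rw [Finset.sum_comm, ← smul_eq_mul, ← Finset.sum_const]
          refine Finset.sum_le_sum fun y _ => ?_
          rw [← hcol y]
          exact Finset.sum_le_sum_of_subset (Finset.subset_univ _)
        exact Nat.le_of_mul_le_mul_right (h1 ▸ h2) (Nat.succ_pos k)
      obtain ⟨f, hf, hf'⟩ := (Finset.all_card_le_biUnion_card_iff_exists_injective _).1 hH
      exact ⟨Equiv.ofBijective f (Finite.injective_iff_bijective.1 hf), fun x => by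
        simpa using hf' x⟩
    obtain ⟨σ, hσ⟩ := ih (fun x y => M x y - if τ x = y then 1 else 0) (by
      intro x
      rw [Finset.sum_tsub_distrib _
        (by intro y _; split_ifs with h; exact h ▸ hτ x; exact zero_le), hrow]
      simp) (by
      intro y
      rw [Finset.sum_tsub_distrib _
        (by intro x _; split_ifs with h; exact h ▸ hτ x; exact zero_le), hcol]
      have : ∀ x, (τ x = y) = (x = τ.symm y) := fun x => by rw [Equiv.eq_symm_apply]
      simp [this])
    refine ⟨Fin.cons τ σ, fun x y => ?_⟩
    have h1 := hσ x y
    have h2 : (if τ x = y then 1 else 0) ≤ M x y := by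
      split_ifs with h
      · exact h ▸ hτ x
      · exact zero_le
    rw [Fin.card_filter_univ_succ]
    simp only [Fin.cons_zero, Fin.cons_succ]
    split_ifs at * <;> omega

end Galvin

/-- `G` has a proper edge colouring in which every edge receives a colour from its list. -/
def ListColorable {V : Type*} (G : SimpleGraph V) (L : Sym2 V → Finset ℕ) : Prop :=
  ∃ φ : Sym2 V → ℕ, (∀ x y, G.Adj x y → φ s(x, y) ∈ L s(x, y)) ∧
    ∀ x y z, G.Adj x y → G.Adj x z → y ≠ z → φ s(x, y) ≠ φ s(x, z)

section Bipartite

variable {V : Type*} [Fintype V] {G : SimpleGraph V} {L : Sym2 V → Finset ℕ} {k : ℕ} {r : V}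

open Classical in
lemma deg_eq_card (G : SimpleGraph V) (v : V) :
    deg G v = (Finset.univ.filter fun y => G.Adj v y).card := by
  rw [deg, ← Set.ncard_coe_finset]
  congr 1
  ext y
  simp

/-- König's edge colouring theorem, with the smallest colours at a prescribed vertex. -/
lemma exists_konig_coloring (hk : ∀ v, deg G v ≤ k)
    (r : V) : ∃ c : V × V → ℕ, (∀ x y, G.Adj x y → c (x, y) < k) ∧
      (∀ y, G.Adj r y → c (r, y) < deg G r) ∧
      (∀ x y z, G.Adj x y → G.Adj x z → c (x, y) = c (x, z) → y = z) ∧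
      (∀ x y z, G.Adj x z → G.Adj y z → c (x, z) = c (y, z) → x = y) := by
  classical
  obtain ⟨σ, hσ⟩ := exists_perm_of_line_sums k
    (fun x y => (if G.Adj x y then 1 else 0) + if x = y then k - deg G x else 0) (by
      intro x
      have := hk x
      rw [Finset.sum_add_distrib, Finset.sum_ite_eq, ← Finset.card_filter, ← deg_eq_card]
      simp
      omega) (by
      intro x
      have := hk x
      simp only [G.adj_comm _ x]
      rw [Finset.sum_add_distrib, Finset.sum_ite_eq', ← Finset.card_filter, ← deg_eq_card]
      simp
      omega)
  have hcard : ∀ x y, G.Adj x y → (Finset.univ.filter fun t => σ t x = y).card = 1 := by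
    intro x y h
    rw [← hσ, if_pos h, if_neg h.ne]
  set C := Finset.univ.filter fun t => G.Adj r (σ t r) with hC
  have hCcard : C.card = deg G r := by
    rw [Finset.card_eq_sum_card_fiberwise (f := fun t => σ t r)
      (t := Finset.univ.filter fun y => G.Adj r y) (by intro t ht; simpa [hC] using ht),
      deg_eq_card, Finset.card_eq_sum_ones]
    refine Finset.sum_congr rfl fun y hy => ?_
    rw [← hcard r y (by simpa using hy)]
    congr 1
    ext t
    simp only [hC, Finset.mem_filter, Finset.mem_univ, true_and] at hy ⊢
    grind
  have e : {t // t ∈ C} ≃ {t : Fin k // t.val < deg G r} := by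
    refine Fintype.equivOfCardEq ?_
    rw [Fintype.card_coe, hCcard, Fintype.card_subtype, Fin.card_filter_val_lt]
    exact (min_eq_right (hk r)).symm
  have hex : ∀ p : V × V, ∃ n : ℕ, G.Adj p.1 p.2 →
      ∃ t : Fin k, σ t p.1 = p.2 ∧ (e.extendSubtype t).val = n := by
    intro p
    by_cases h : G.Adj p.1 p.2
    · obtain ⟨t, ht⟩ := Finset.card_eq_one.1 (hcard _ _ h)
      have : t ∈ Finset.univ.filter fun t => σ t p.1 = p.2 := by simp [ht]
      exact ⟨_, fun _ => ⟨t, by simpa using this, rfl⟩⟩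
    · exact ⟨0, fun h' => absurd h' h⟩
  choose c hc using hex
  refine ⟨c, ?_, ?_, ?_, ?_⟩
  · intro x y h
    obtain ⟨t, -, ht⟩ := hc (x, y) h
    exact ht ▸ (e.extendSubtype t).2
  · intro y h
    obtain ⟨t, hty, ht⟩ := hc (r, y) h
    rw [← ht]
    exact e.extendSubtype_mem t (by simp only [hC, Finset.mem_filter]; grind)
  · intro x y z hy hz heq
    obtain ⟨t, hty, ht⟩ := hc (x, y) hy
    obtain ⟨t', htz, ht'⟩ := hc (x, z) hz
    have : t = t' := e.extendSubtype.injective (Fin.ext (by rw [ht, ht', heq]))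
    subst this
    exact hty.symm.trans htz
  · intro x y z hx hy heq
    obtain ⟨t, hty, ht⟩ := hc (x, z) hx
    obtain ⟨t', htz, ht'⟩ := hc (y, z) hy
    have : t = t' := e.extendSubtype.injective (Fin.ext (by rw [ht, ht', heq]))
    subst this
    exact (σ t).injective (hty.trans htz.symm)

lemma listColorable_of_mem_bipartition (S : Set V) (hS : ∀ x y, G.Adj x y → (x ∈ S ↔ y ∉ S))
    (hk : ∀ v, deg G v ≤ k) (hrS : r ∈ S)
    (hr : ∀ y, G.Adj r y → deg G r ≤ (L s(r, y)).card)
    (hL : ∀ x y, G.Adj x y → x ≠ r → y ≠ r → k ≤ (L s(x, y)).card) : ListColorable G L := by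
  classical
  obtain ⟨c, hck, hcr, hrow, hcol⟩ := exists_konig_coloring hk r
  set E : Finset (V × V) := Finset.univ.filter fun e => e.1 ∈ S ∧ G.Adj e.1 e.2 with hE
  have hmem : ∀ e, e ∈ E ↔ e.1 ∈ S ∧ G.Adj e.1 e.2 := by simp [hE]
  obtain ⟨φ, hφ, hφ'⟩ := exists_list_coloring_of_card_lt E c (fun e => L s(e.1, e.2))
    (by
      rintro ⟨x, y⟩ he ⟨x', y'⟩ hf (rfl : x = x') hc
      rw [hmem] at he hf
      rw [hrow x y y' he.2 hf.2 hc])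
    (by
      rintro ⟨x, y⟩ he ⟨x', y'⟩ hf (rfl : y = y') hc
      rw [hmem] at he hf
      rw [hcol x x' y he.2 hf.2 hc])
    (by
      have key : ∀ x y K, (x, y) ∈ E → (∀ z, G.Adj x z → c (x, z) < K) →
          {f ∈ (E : Set (V × V)) | (f.1 = x ∧ c (x, y) < c f) ∨
            (f.2 = y ∧ c f < c (x, y))}.ncard < K := by
        intro x y K he hK
        rw [hmem] at he
        have hcK := hK y he.2
        have h1 : ((Finset.range K).erase (c (x, y))).card < K := by
          rw [Finset.card_erase_of_mem (by simpa using hcK), Finset.card_range]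
          omega
        refine lt_of_le_of_lt ?_ h1
        rw [← Set.ncard_coe_finset]
        refine Set.ncard_le_ncard_of_injOn c ?_ ?_ (Finset.finite_toSet _)
        · rintro ⟨u, v⟩ ⟨huv, h⟩
          rw [Finset.mem_coe, hmem] at huv
          rw [Finset.mem_coe, Finset.mem_erase, Finset.mem_range]
          rcases h with ⟨rfl, h⟩ | ⟨rfl, h⟩
          · exact ⟨h.ne', hK _ huv.2⟩
          · exact ⟨h.ne, h.trans hcK⟩
        · rintro ⟨u, v⟩ ⟨huv, h⟩ ⟨u', v'⟩ ⟨huv', h'⟩ heq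
          rw [Finset.mem_coe, hmem] at huv huv'
          rcases h with ⟨rfl, h⟩ | ⟨rfl, h⟩ <;> rcases h' with ⟨h2, h'⟩ | ⟨h2, h'⟩
          · simp only at h2
            subst h2
            exact Prod.ext rfl (hrow _ _ _ huv.2 huv'.2 heq)
          · omega
          · omega
          · simp only at h2
            subst h2
            exact Prod.ext (hcol _ _ _ huv.2 huv'.2 heq) rfl
      rintro ⟨x, y⟩ he
      have he' := (hmem _).1 he
      by_cases hx : x = r
      · subst hx
        exact (key x y _ he hcr).trans_le (hr y he'.2)
      · refine (key x y _ he fun z hz => hck x z hz).trans_le (hL x y he'.2 hx ?_)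
        rintro rfl
        exact (hS _ _ he'.2).1 he'.1 hrS)
  have hex : ∀ e : Sym2 V, ∃ n, ∀ x y, x ∈ S → G.Adj x y → e = s(x, y) → φ (x, y) = n := by
    intro e
    by_cases h : ∃ x y, x ∈ S ∧ G.Adj x y ∧ e = s(x, y)
    · obtain ⟨x, y, hx, hxy, rfl⟩ := h
      refine ⟨φ (x, y), fun x' y' hx' hxy' h => ?_⟩
      rcases Sym2.eq_iff.1 h with ⟨rfl, rfl⟩ | ⟨rfl, rfl⟩
      · rfl
      · exact absurd hx' ((hS _ _ hxy).1 hx)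
    · exact ⟨0, fun x y hx hxy he => absurd ⟨x, y, hx, hxy, he⟩ h⟩
  choose ψ hψ using hex
  refine ⟨ψ, ?_, ?_⟩
  · intro x y hxy
    by_cases hx : x ∈ S
    · rw [← hψ _ x y hx hxy rfl]
      exact hφ (x, y) ((hmem _).2 ⟨hx, hxy⟩)
    · have hy : y ∈ S := by by_contra hy; exact hx ((hS _ _ hxy).2 hy)
      rw [Sym2.eq_swap, ← hψ _ y x hy hxy.symm rfl]
      exact hφ (y, x) ((hmem _).2 ⟨hy, hxy.symm⟩)
  · intro x y z hxy hxz hyz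
    by_cases hx : x ∈ S
    · rw [← hψ _ x y hx hxy rfl, ← hψ _ x z hx hxz rfl]
      exact hφ' _ ((hmem _).2 ⟨hx, hxy⟩) _ ((hmem _).2 ⟨hx, hxz⟩) (by simpa using hyz)
        (Or.inl rfl)
    · have hy : y ∈ S := by by_contra hy; exact hx ((hS _ _ hxy).2 hy)
      have hz : z ∈ S := by by_contra hz; exact hx ((hS _ _ hxz).2 hz)
      rw [Sym2.eq_swap, ← hψ _ y x hy hxy.symm rfl, Sym2.eq_swap (a := x),
        ← hψ _ z x hz hxz.symm rfl]
      exact hφ' _ ((hmem _).2 ⟨hy, hxy.symm⟩) _ ((hmem _).2 ⟨hz, hxz.symm⟩) (by simpa using hyz)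
        (Or.inr rfl)

/-- Galvin's theorem, with shorter lists at a prescribed vertex. -/
lemma listColorable_of_bipartition (S : Set V) (hS : ∀ x y, G.Adj x y → (x ∈ S ↔ y ∉ S))
    (hk : ∀ v, deg G v ≤ k) (r : V)
    (hr : ∀ y, G.Adj r y → deg G r ≤ (L s(r, y)).card)
    (hL : ∀ x y, G.Adj x y → x ≠ r → y ≠ r → k ≤ (L s(x, y)).card) : ListColorable G L := by
  by_cases hrS : r ∈ S
  · exact listColorable_of_mem_bipartition S hS hk hrS hr hL
  · exact listColorable_of_mem_bipartition Sᶜ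
      (fun x y h => by simpa using not_congr (hS x y h)) hk hrS hr hL

end Bipartite

section Glue

variable {V : Type*} {G H G₁ G₂ : SimpleGraph V} {L L' : Sym2 V → Finset ℕ} {a b c d x : V}

lemma InGStar.mono (hG : InGStar G) (h : H ≤ G) : InGStar H := by
  intro u w c₁ c₂ h₁ h₂ o₁ o₂ hne
  have := hG u w (c₁.mapLe h) (c₂.mapLe h) (h₁.mapLe h) (h₂.mapLe h) (by simpa using o₁)
    (by simpa using o₂)
  simp only [Walk.edges_mapLe_eq_edges] at this
  exact this hne

lemma deg_mono [Finite V] (h : H ≤ G) (v : V) : deg H v ≤ deg G v :=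
  Set.ncard_le_ncard fun _ hy => h hy

lemma deg_le_two_of_forall {u v : V} (h : ∀ y, G.Adj x y → y = u ∨ y = v) : deg G x ≤ 2 := by
  refine (Set.ncard_le_ncard (t := {u, v}) (fun y hy => by simpa using h y hy)
    (by simp)).trans ?_
  exact (Set.ncard_insert_le u {v}).trans (by simp)

lemma deg_add_one_le [Finite V] (h : H ≤ G) {v y : V} (hy : G.Adj v y) (hy' : ¬ H.Adj v y) :
    deg H v + 1 ≤ deg G v :=
  Set.ncard_lt_ncard ⟨fun _ hz => h hz, fun hsub => hy' (hsub hy)⟩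

lemma ListColorable.mono (h : ListColorable G L) (hL : ∀ x y, G.Adj x y → L s(x, y) ⊆ L' s(x, y)) :
    ListColorable G L' := by
  obtain ⟨φ, h₁, h₂⟩ := h
  exact ⟨φ, fun x y hxy => hL x y hxy (h₁ x y hxy), h₂⟩

open Classical in
/-- The colours of `L e` that `φ` does not use on the edges of `G₁` meeting `e`. -/
noncomputable def availableColors (G₁ : SimpleGraph V) (φ : Sym2 V → ℕ) (L : Sym2 V → Finset ℕ)
    (e : Sym2 V) : Finset ℕ :=
  (L e).filter fun c => ∀ x y, x ∈ e → G₁.Adj x y → φ s(x, y) ≠ c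

lemma mem_availableColors {φ : Sym2 V → ℕ} {e : Sym2 V} {c : ℕ} : c ∈ availableColors G₁ φ L e ↔
    c ∈ L e ∧ ∀ x y, x ∈ e → G₁.Adj x y → φ s(x, y) ≠ c := by
  simp [availableColors]

/-- A partial colouring can be completed if the rest is colourable from the lists of colours not
yet used at its vertices. -/
lemma ListColorable.glue {φ : Sym2 V → ℕ} (hG : ∀ x y, G.Adj x y → G₁.Adj x y ∨ G₂.Adj x y)
    (hφ : ∀ x y, G₁.Adj x y → φ s(x, y) ∈ L s(x, y))
    (hφ' : ∀ x y z, G₁.Adj x y → G₁.Adj x z → y ≠ z → φ s(x, y) ≠ φ s(x, z))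
    (h₂ : ListColorable G₂ (availableColors G₁ φ L)) : ListColorable G L := by
  classical
  obtain ⟨ψ, hψ, hψ'⟩ := h₂
  simp only [mem_availableColors] at hψ
  have h1 : ∀ x y, G₁.Adj x y → (if s(x, y) ∈ G₁.edgeSet then φ s(x, y) else ψ s(x, y)) =
      φ s(x, y) := fun x y h => if_pos h
  have h2 : ∀ x y, ¬ G₁.Adj x y → (if s(x, y) ∈ G₁.edgeSet then φ s(x, y) else ψ s(x, y)) =
      ψ s(x, y) := fun x y h => if_neg h
  refine ⟨fun e => if e ∈ G₁.edgeSet then φ e else ψ e, fun x y hxy => ?_,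
    fun x y z hxy hxz hyz => ?_⟩
  · by_cases h : G₁.Adj x y
    · simpa only [h1 x y h] using hφ x y h
    · simpa only [h2 x y h] using (hψ x y ((hG x y hxy).resolve_left h)).1
  · by_cases hy : G₁.Adj x y <;> by_cases hz : G₁.Adj x z
    · simpa only [h1 x y hy, h1 x z hz] using hφ' x y z hy hz hyz
    · simpa only [h1 x y hy, h2 x z hz] using
        (hψ x z ((hG x z hxz).resolve_left hz)).2 x y (by simp) hy
    · simpa only [h2 x y hy, h1 x z hz] using
        ((hψ x y ((hG x y hxy).resolve_left hy)).2 x z (by simp) hz).symm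
    · simpa only [h2 x y hy, h2 x z hz] using hψ' x y z ((hG x y hxy).resolve_left hy)
        ((hG x z hxz).resolve_left hz) hyz

lemma card_le_card_availableColors_add {φ : Sym2 V → ℕ} (C : Finset ℕ) (e : Sym2 V)
    (hC : ∀ x y, x ∈ e → G₁.Adj x y → φ s(x, y) ∈ C) :
    (L e).card ≤ (availableColors G₁ φ L e).card + C.card := by
  refine (Finset.card_le_card ?_).trans (Finset.card_union_le _ _)
  intro c hc
  by_cases hcC : c ∈ C
  · exact Finset.mem_union_right _ hcC
  · refine Finset.mem_union_left _ (mem_availableColors.2 ⟨hc, fun x y hx hxy h => hcC ?_⟩)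
    exact h ▸ hC x y hx hxy

/-- An edge with few neighbouring edges can be coloured last. -/
lemma listColorable_of_deleteEdges [Finite V] {x y : V} (hxy : G.Adj x y)
    (h : ListColorable (G.deleteEdges {s(x, y)}) L)
    (hcard : deg G x + deg G y ≤ (L s(x, y)).card + 1) : ListColorable G L := by
  classical
  obtain ⟨φ, hφ, hφ'⟩ := h
  refine ListColorable.glue (G₁ := G.deleteEdges {s(x, y)}) (G₂ := edge x y) (φ := φ) ?_ hφ hφ' ?_
  · intro u v huv
    rw [edge_adj, deleteEdges_adj]
    by_cases h : s(u, v) = s(x, y)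
    · refine Or.inr ⟨?_, huv.ne⟩
      simpa using h
    · exact Or.inl ⟨huv, h⟩
  · have hx := deg_add_one_le (G := G) (H := G.deleteEdges {s(x, y)}) (deleteEdges_le _) hxy
      (by simp)
    have hy := deg_add_one_le (G := G) (H := G.deleteEdges {s(x, y)}) (deleteEdges_le _) hxy.symm
      (by simp)
    have hfin : ∀ v, ((G.deleteEdges {s(x, y)}).neighborSet v).Finite := fun v => Set.toFinite _
    have hpos := card_le_card_availableColors_add (L := L) (G₁ := G.deleteEdges {s(x, y)}) (φ := φ)
      (((hfin x).toFinset.image fun z => φ s(x, z)) ∪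
        ((hfin y).toFinset.image fun z => φ s(y, z))) s(x, y) (by
        intro u v hu huv
        rcases Sym2.mem_iff.1 hu with rfl | rfl
        · exact Finset.mem_union_left _ (Finset.mem_image_of_mem _ (by simpa using huv))
        · exact Finset.mem_union_right _ (Finset.mem_image_of_mem _ (by simpa using huv)))
    have hc1 := Finset.card_union_le ((hfin x).toFinset.image fun z => φ s(x, z))
        ((hfin y).toFinset.image fun z => φ s(y, z))
    have hc2 := Finset.card_image_le (s := (hfin x).toFinset) (f := fun z => φ s(x, z))
    have hc3 := Finset.card_image_le (s := (hfin y).toFinset) (f := fun z => φ s(y, z))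
    rw [← Set.ncard_eq_toFinset_card] at hc2 hc3
    change _ ≤ deg _ _ at hc2 hc3
    obtain ⟨α, hα⟩ : (availableColors (G.deleteEdges {s(x, y)}) φ L s(x, y)).Nonempty :=
      Finset.card_pos.1 (by omega)
    refine ⟨fun _ => α, ?_, ?_⟩
    · intro u v huv
      rw [edge_adj] at huv
      have : s(u, v) = s(x, y) := by simpa using huv.1
      rwa [this]
    · intro u v w huv huw hvw
      rw [edge_adj] at huv huw
      grind

end Glue

section SmallCases

lemma exists_mem_ne {A : Finset ℕ} (h : 2 ≤ A.card) (x : ℕ) : ∃ a ∈ A, a ≠ x := by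
  obtain ⟨a, ha, hax⟩ := Finset.exists_mem_ne (s := A) h x
  exact ⟨a, ha, hax⟩

lemma exists_mem_ne_ne {A : Finset ℕ} (h : 3 ≤ A.card) (x y : ℕ) : ∃ a ∈ A, a ≠ x ∧ a ≠ y := by
  have := Finset.pred_card_le_card_erase (s := A) (a := x)
  obtain ⟨a, ha, hax⟩ := exists_mem_ne (A := A.erase x) (by omega) y
  exact ⟨a, Finset.mem_of_mem_erase ha, Finset.ne_of_mem_erase ha, hax⟩

/-- The four-cycle is 2-choosable. -/
lemma exists_four_cycle_coloring {A B C D : Finset ℕ} (hA : 2 ≤ A.card) (hB : 2 ≤ B.card)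
    (hC : 2 ≤ C.card) (hD : 2 ≤ D.card) :
    ∃ a ∈ A, ∃ b ∈ B, ∃ c ∈ C, ∃ d ∈ D, a ≠ b ∧ b ≠ c ∧ c ≠ d ∧ d ≠ a := by
  have key : ∀ {A B C D : Finset ℕ}, 2 ≤ B.card → 2 ≤ C.card → 2 ≤ D.card → ¬ A ⊆ B →
      ∃ a ∈ A, ∃ b ∈ B, ∃ c ∈ C, ∃ d ∈ D, a ≠ b ∧ b ≠ c ∧ c ≠ d ∧ d ≠ a := by
    intro A B C D hB hC hD hAB
    obtain ⟨a, ha, hab⟩ := Finset.not_subset.1 hAB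
    obtain ⟨d, hd, hda⟩ := exists_mem_ne hD a
    obtain ⟨c, hc, hcd⟩ := exists_mem_ne hC d
    obtain ⟨b, hb, hbc⟩ := exists_mem_ne hB c
    exact ⟨a, ha, b, hb, c, hc, d, hd, fun h => hab (h ▸ hb), hbc, hcd, hda⟩
  by_cases h1 : A ⊆ B
  · by_cases h2 : B ⊆ C
    · by_cases h3 : C ⊆ D
      · obtain ⟨a, ha, b, hb, hab⟩ := Finset.one_lt_card.1 hA
        exact ⟨a, ha, b, h1 hb, a, h2 (h1 ha), b, h3 (h2 (h1 hb)), hab, hab.symm, hab, hab.symm⟩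
      · obtain ⟨c, hc, d, hd, a, ha, b, hb, h⟩ := key hD hA hB h3
        exact ⟨a, ha, b, hb, c, hc, d, hd, by tauto⟩
    · obtain ⟨b, hb, c, hc, d, hd, a, ha, h⟩ := key hC hD hA h2
      exact ⟨a, ha, b, hb, c, hc, d, hd, by tauto⟩
  · exact key hB hC hD h1

/-- The wheel with four spokes can be coloured from lists of size 3, two of which, at adjacent
rim vertices, may have size 2. -/
lemma exists_wheel_coloring {P Q T A B : Finset ℕ} (hP : 2 ≤ P.card) (hQ : 2 ≤ Q.card)
    (hT : 3 ≤ T.card) (hA : 3 ≤ A.card) (hB : 3 ≤ B.card) :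
    ∃ p ∈ P, ∃ q ∈ Q, ∃ t ∈ T, ∃ f ∈ A, ∃ g ∈ B, p ≠ q ∧ p ≠ t ∧ q ≠ t ∧ p ≠ f ∧ q ≠ g ∧
      t ≠ f ∧ t ≠ g ∧ f ≠ g := by
  obtain ⟨P', hP', hPc⟩ := Finset.exists_subset_card_eq hP
  obtain ⟨Q', hQ', hQc⟩ := Finset.exists_subset_card_eq hQ
  suffices h : ∃ p ∈ P', ∃ q ∈ Q', ∃ t ∈ T, ∃ f ∈ A, ∃ g ∈ B, p ≠ q ∧ p ≠ t ∧ q ≠ t ∧ p ≠ f ∧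
      q ≠ g ∧ t ≠ f ∧ t ≠ g ∧ f ≠ g by
    obtain ⟨p, hp, q, hq, h⟩ := h
    exact ⟨p, hP' hp, q, hQ' hq, h⟩
  by_cases hsub : ∃ t ∈ T, t ∉ P' ∧ t ∉ Q'
  · obtain ⟨t, ht, htP, htQ⟩ := hsub
    have hA' := Finset.pred_card_le_card_erase (s := A) (a := t)
    have hB' := Finset.pred_card_le_card_erase (s := B) (a := t)
    obtain ⟨p, hp, q, hq, g, hg, f, hf, h1, h2, h3, h4⟩ :=
      exists_four_cycle_coloring (A := P') (B := Q') (C := B.erase t) (D := A.erase t)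
        hPc.ge hQc.ge (by omega) (by omega)
    rw [Finset.mem_erase] at hf hg
    exact ⟨p, hp, q, hq, t, ht, f, hf.2, g, hg.2, h1, fun h => htP (h ▸ hp), fun h => htQ (h ▸ hq),
      h4.symm, h2, hf.1.symm, hg.1.symm, h3.symm⟩
  push Not at hsub
  obtain ⟨p₁, p₂, hp, rfl⟩ := Finset.card_eq_two.1 hPc
  obtain ⟨q₁, q₂, hq, rfl⟩ := Finset.card_eq_two.1 hQc
  simp only [Finset.mem_insert, Finset.mem_singleton, not_or] at hsub
  have hdisj : ∀ {p₁ p₂ q₁ q₂ : ℕ} {A B : Finset ℕ}, p₁ ≠ p₂ → q₁ ≠ q₂ → 3 ≤ A.card → 3 ≤ B.card →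
      p₁ ≠ q₁ → p₁ ≠ q₂ → p₂ ≠ q₁ → p₂ ≠ q₂ →
      ∃ q, (q = q₁ ∨ q = q₂) ∧ ∃ f ∈ A, ∃ g ∈ B, p₂ ≠ q ∧ q ≠ p₁ ∧ p₂ ≠ f ∧ q ≠ g ∧ p₁ ≠ f ∧
        p₁ ≠ g ∧ f ≠ g := by
    intro p₁ p₂ q₁ q₂ A B hp hq hA hB h1 h2 h3 h4
    obtain ⟨f, hf, hf1, hf2⟩ := exists_mem_ne_ne hA p₁ p₂
    obtain ⟨g, hg, hg1, hg2⟩ := exists_mem_ne_ne hB p₁ f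
    by_cases h : g = q₁
    · exact ⟨q₂, Or.inr rfl, f, hf, g, hg, by grind⟩
    · exact ⟨q₁, Or.inl rfl, f, hf, g, hg, by grind⟩
  have hmeet : ∀ {c u v : ℕ} {T A B : Finset ℕ}, c ≠ u → c ≠ v → 3 ≤ T.card → 3 ≤ A.card →
      3 ≤ B.card → (∀ t ∈ T, t = c ∨ t = u ∨ t = v) → ∃ p, (p = c ∨ p = u) ∧
        ∃ q, (q = c ∨ q = v) ∧ ∃ t ∈ T, ∃ f ∈ A, ∃ g ∈ B, p ≠ q ∧ p ≠ t ∧ q ≠ t ∧ p ≠ f ∧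
          q ≠ g ∧ t ≠ f ∧ t ≠ g ∧ f ≠ g := by
    intro c u v T A B hcu hcv hT hA hB hsub
    obtain ⟨t, ht, ht1, ht2⟩ := exists_mem_ne_ne hT c v
    obtain ⟨t', ht', ht1', ht2'⟩ := exists_mem_ne_ne hT c u
    obtain rfl : t = u := by grind
    obtain rfl : t' = v := by grind
    obtain ⟨f, hf, hf1, hf2⟩ := exists_mem_ne_ne hA t c
    obtain ⟨g, hg, hg1, hg2⟩ := exists_mem_ne_ne hB t t'
    by_cases hfg : f = g
    · by_cases hcA : c ∈ A
      · by_cases htB : t ∈ B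
        · exact ⟨t, Or.inr rfl, c, Or.inl rfl, t', ht', c, hcA, t, htB, by grind⟩
        · obtain ⟨g', hg', hg1', hg2'⟩ := exists_mem_ne_ne hB t' f
          exact ⟨c, Or.inl rfl, t', Or.inr rfl, t, ht, f, hf, g', hg', by grind⟩
      · obtain ⟨f', hf', hf1', hf2'⟩ := exists_mem_ne_ne hA t g
        exact ⟨c, Or.inl rfl, t', Or.inr rfl, t, ht, f', hf', g, hg, by grind⟩
    · exact ⟨c, Or.inl rfl, t', Or.inr rfl, t, ht, f, hf, g, hg, by grind⟩
  simp only [Finset.mem_insert, Finset.mem_singleton]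
  by_cases h11 : p₁ = q₁
  · subst h11
    obtain ⟨p, hp, q, hq, h⟩ := hmeet (c := p₁) (u := p₂) (v := q₂) hp hq hT hA hB (by grind)
    exact ⟨p, hp, q, hq, h⟩
  by_cases h12 : p₁ = q₂
  · subst h12
    obtain ⟨p, hp, q, hq, h⟩ := hmeet (c := p₁) (u := p₂) (v := q₁) hp h11 hT hA hB (by grind)
    exact ⟨p, hp, q, hq.symm, h⟩
  by_cases h21 : p₂ = q₁
  · subst h21
    obtain ⟨p, hp, q, hq, h⟩ := hmeet (c := p₂) (u := p₁) (v := q₂) hp.symm hq hT hA hB (by grind)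
    exact ⟨p, hp.symm, q, hq, h⟩
  by_cases h22 : p₂ = q₂
  · subst h22
    obtain ⟨p, hp, q, hq, h⟩ := hmeet (c := p₂) (u := p₁) (v := q₁) hp.symm h21 hT hA hB (by grind)
    exact ⟨p, hp.symm, q, hq.symm, h⟩
  have hmem : ∀ x y, x ∉ T → y ∉ T → (x = p₁ ∨ x = p₂) → (y = q₁ ∨ y = q₂) → False := by
    intro x y hx hy hxp hyq
    obtain ⟨t, ht, h1, h2⟩ := exists_mem_ne_ne hT (if x = p₁ then p₂ else p₁)
      (if y = q₁ then q₂ else q₁)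
    grind
  by_cases hpT : p₁ ∈ T ∧ p₂ ∈ T
  · obtain ⟨q, hq, f, hf, g, hg, h⟩ := hdisj hp hq hA hB h11 h12 h21 h22
    exact ⟨p₂, Or.inr rfl, q, hq, p₁, hpT.1, f, hf, g, hg, by grind⟩
  · have hqT : q₁ ∈ T ∧ q₂ ∈ T := by grind
    obtain ⟨p, hp, g, hg, f, hf, h⟩ := hdisj hq hp hB hA (Ne.symm h11) (Ne.symm h21)
      (Ne.symm h12) (Ne.symm h22)
    exact ⟨p, hp, q₂, Or.inr rfl, q₁, hqT.1, f, hf, g, hg, by grind⟩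

/-- Six lists of size 3 on the octahedron, given as three antipodal pairs. -/
lemma exists_injective_of_disjoint {A A' B B' C C' : Finset ℕ} (hA : 3 ≤ A.card)
    (hA' : 3 ≤ A'.card) (hB : 3 ≤ B.card) (hB' : 3 ≤ B'.card) (hC : 3 ≤ C.card)
    (hC' : 3 ≤ C'.card) (dA : Disjoint A A') (dB : Disjoint B B') (dC : Disjoint C C') :
    ∃ f : Fin 6 → ℕ, Function.Injective f ∧ f 0 ∈ A ∧ f 1 ∈ A' ∧ f 2 ∈ B ∧ f 3 ∈ B' ∧
      f 4 ∈ C ∧ f 5 ∈ C' := by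
  have hH : ∀ S : Finset (Fin 6), S.card ≤ (S.biUnion ![A, A', B, B', C, C']).card := by
    intro S
    have hS : S = ∅ ∨ (S.Nonempty ∧ S.card ≤ 3) ∨ (0 ∈ S ∧ 1 ∈ S) ∨ (2 ∈ S ∧ 3 ∈ S) ∨
        (4 ∈ S ∧ 5 ∈ S) := by
      revert S
      decide
    have hS6 : S.card ≤ 6 := by simpa using S.card_le_univ
    have h3 : ∀ i, 3 ≤ (![A, A', B, B', C, C'] i).card := by
      intro i
      fin_cases i <;> assumption
    have hsub : ∀ i ∈ S, ![A, A', B, B', C, C'] i ⊆ S.biUnion ![A, A', B, B', C, C'] :=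
      fun i hi => Finset.subset_biUnion_of_mem _ hi
    have hpair : ∀ i j, i ∈ S → j ∈ S → Disjoint (![A, A', B, B', C, C'] i)
        (![A, A', B, B', C, C'] j) → 6 ≤ (S.biUnion ![A, A', B, B', C, C']).card := by
      intro i j hi hj hd
      have := Finset.card_le_card (Finset.union_subset (hsub i hi) (hsub j hj))
      rw [Finset.card_union_of_disjoint hd] at this
      have := h3 i
      have := h3 j
      omega
    rcases hS with rfl | ⟨⟨i, hi⟩, hc⟩ | ⟨h, h'⟩ | ⟨h, h'⟩ | ⟨h, h'⟩
    · simp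
    · exact hc.trans ((h3 i).trans (Finset.card_le_card (hsub i hi)))
    · exact hS6.trans (hpair _ _ h h' dA)
    · exact hS6.trans (hpair _ _ h h' dB)
    · exact hS6.trans (hpair _ _ h h' dC)
  obtain ⟨f, hf, hf'⟩ := (Finset.all_card_le_biUnion_card_iff_exists_injective _).1 hH
  exact ⟨f, hf, hf' 0, hf' 1, hf' 2, hf' 3, hf' 4, hf' 5⟩

end SmallCases

section Book

variable {V : Type*} {G G₁ G₂ : SimpleGraph V} {L : Sym2 V → Finset ℕ} {a b u v w x y : V} {k : ℕ}

lemma colorable_two_of_bipartition (S : Set V) (hS : ∀ x y, G.Adj x y → (x ∈ S ↔ y ∉ S)) :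
    G.Colorable 2 := by
  classical
  exact (Coloring.mk (fun x => decide (x ∈ S)) fun {x y} h heq => by
    have := hS x y h
    simp only [decide_eq_decide] at heq
    tauto : G.Coloring Bool).colorable

lemma exists_bipartition_of_colorable (h : G.Colorable 2) :
    ∃ S : Set V, ∀ x y, G.Adj x y → (x ∈ S ↔ y ∉ S) := by
  obtain ⟨C⟩ := h
  refine ⟨{x | C x = 0}, fun x y hxy => ?_⟩
  have := C.valid hxy
  simp only [Set.mem_ofPred_eq]
  omega

lemma Nonseparable.exists_adj_ne (hN : Nonseparable G) (h2 : ¬ G.Colorable 2) (hxy : G.Adj x y) :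
    ∃ z, z ≠ y ∧ G.Adj x z := by
  by_contra! h
  refine h2 (colorable_two_of_bipartition {x} fun p q hpq => ?_)
  have hU : ∀ z ∈ ({x, y} : Set V), z ≠ y → ∀ t, G.Adj z t → t ∈ ({x, y} : Set V) := by
    intro z hz hzy t ht
    obtain rfl : z = x := by simpa [hzy] using hz
    by_contra hty
    exact h t (by simp_all) ht
  have hp := hN.mem_of_adj y hU (by simp) (by simp) hxy hpq
  have hq := hN.mem_of_adj y hU (by simp) (by simp) hxy hpq.symm
  have := hpq.ne
  have := hxy.ne
  simp only [Set.mem_insert_iff, Set.mem_singleton_iff] at hp hq ⊢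
  grind

/-- `G` is edge-colourable from all lists which have size at least `k`, except that at some vertex
the size is only required to be at least the degree of this vertex. -/
def RootListColorable (G : SimpleGraph V) (k : ℕ) : Prop :=
  ∀ (r : V) (L : Sym2 V → Finset ℕ), (∀ y, G.Adj r y → deg G r ≤ (L s(r, y)).card) →
    (∀ x y, G.Adj x y → x ≠ r → y ≠ r → k ≤ (L s(x, y)).card) → ListColorable G L

lemma RootListColorable.of_separation [Finite V] (hG : G₁ ⊔ G₂ = G)
    (hw : ∀ v, v ≠ w → ∀ x y, G₁.Adj v x → ¬ G₂.Adj v y) (hk : ∀ v, deg G v ≤ k)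
    (h₁ : RootListColorable G₁ k) (h₂ : RootListColorable G₂ k) : RootListColorable G k := by
  classical
  have key : ∀ {G₁ G₂ : SimpleGraph V}, G₁ ⊔ G₂ = G →
      (∀ v, v ≠ w → ∀ x y, G₁.Adj v x → ¬ G₂.Adj v y) → RootListColorable G₁ k →
      RootListColorable G₂ k → ∀ (r : V) (L : Sym2 V → Finset ℕ), (r = w ∨ ∀ y, ¬ G₂.Adj r y) →
      (∀ y, G.Adj r y → deg G r ≤ (L s(r, y)).card) →
      (∀ x y, G.Adj x y → x ≠ r → y ≠ r → k ≤ (L s(x, y)).card) → ListColorable G L := by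
    intro G₁ G₂ hG hw h₁ h₂ r L hr hLr hL
    have l₁ : G₁ ≤ G := hG ▸ le_sup_left
    have l₂ : G₂ ≤ G := hG ▸ le_sup_right
    obtain ⟨φ, hφ, hφ'⟩ := h₁ r L (fun y hy => (deg_mono l₁ r).trans (hLr y (l₁ hy)))
      (fun x y hxy => hL x y (l₁ hxy))
    refine ListColorable.glue (G₁ := G₁) (G₂ := G₂) (φ := φ) ?_ hφ hφ' (h₂ w _ ?_ ?_)
    · intro x y hxy
      rw [← hG] at hxy
      exact hxy
    · intro y hy
      have hfin : (G₁.neighborSet w).Finite := Set.toFinite _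
      have hc := card_le_card_availableColors_add (L := L) (G₁ := G₁) (φ := φ)
        (hfin.toFinset.image fun z => φ s(w, z)) s(w, y) (by
          intro u v hu huv
          rcases Sym2.mem_iff.1 hu with rfl | rfl
          · exact Finset.mem_image_of_mem _ (by simpa using huv)
          · exact absurd hy.symm (hw _ hy.ne' _ _ huv))
      have hc' := Finset.card_image_le (s := hfin.toFinset) (f := fun z => φ s(w, z))
      rw [← Set.ncard_eq_toFinset_card] at hc'
      change _ ≤ deg G₁ w at hc'
      have hd : deg G₁ w + deg G₂ w ≤ deg G w := by
        rw [deg, deg, deg, ← Set.ncard_union_eq ?_ (Set.toFinite _) (Set.toFinite _)]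
        · refine Set.ncard_le_ncard ?_
          rintro z (hz | hz)
          · exact l₁ hz
          · exact l₂ hz
        · refine Set.disjoint_left.2 fun z hz hz' => ?_
          exact hw z (Adj.ne' hz) w w (Adj.symm hz) (Adj.symm hz')
      have hL' : deg G w ≤ (L s(w, y)).card := by
        by_cases hrw : r = w
        · subst hrw
          exact hLr y (l₂ hy)
        · refine (hk w).trans (hL w y (l₂ hy) (Ne.symm hrw) ?_)
          rintro rfl
          exact hr.resolve_left hrw w hy.symm
      omega
    · intro x y hxy hx hy
      have hc := card_le_card_availableColors_add (L := L) (G₁ := G₁) (φ := φ) ∅ s(x, y) (by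
          intro u v hu huv
          rcases Sym2.mem_iff.1 hu with rfl | rfl
          · exact absurd hxy (hw _ hx _ _ huv)
          · exact absurd hxy.symm (hw _ hy _ _ huv))
      rw [Finset.card_empty, add_zero] at hc
      refine (hL x y (l₂ hxy) ?_ ?_).trans hc
      · rintro rfl
        exact hr.resolve_left hx y hxy
      · rintro rfl
        exact hr.resolve_left hy x hxy.symm
  intro r L hLr hL
  by_cases hr : r = w ∨ ∀ y, ¬ G₂.Adj r y
  · exact key hG hw h₁ h₂ r L hr hLr hL
  · push Not at hr
    obtain ⟨hrw, y, hy⟩ := hr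
    exact key (sup_comm G₁ G₂ ▸ hG) (fun v hv x y hx hy => hw v hv y x hy hx) h₂ h₁ r L
      (Or.inr fun z hz => hw r hrw z y hz hy) hLr hL

lemma listColorable_of_erase {α : ℕ} (hα : α ∈ L s(a, b))
    (h : ListColorable (G.deleteEdges {s(a, b)}) (fun e => (L e).erase α)) : ListColorable G L := by
  refine ListColorable.glue (G₁ := edge a b) (G₂ := G.deleteEdges {s(a, b)}) (φ := fun _ => α)
    ?_ ?_ ?_ (h.mono fun x y _ c hc => ?_)
  · intro u v huv
    rw [edge_adj, deleteEdges_adj]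
    by_cases h : s(u, v) = s(a, b)
    · exact Or.inl ⟨by simpa using h, huv.ne⟩
    · exact Or.inr ⟨huv, h⟩
  · intro u v huv
    rw [edge_adj] at huv
    have : s(u, v) = s(a, b) := by simpa using huv.1
    rwa [this]
  · intro u v w huv huw hvw
    rw [edge_adj] at huv huw
    grind
  · rw [Finset.mem_erase] at hc
    exact mem_availableColors.2 ⟨hc.2, fun _ _ _ _ h => hc.1 h.symm⟩

/-- A complete bipartite graph with parts `{a, b}` and its complement, plus the edge `ab`. -/
lemma listColorable_of_book [Fintype V] (h3 : 3 ≤ k) (hk : ∀ v, deg G v ≤ k) (hab : G.Adj a b)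
    (hbook : ∀ x y, G.Adj x y → x ≠ a → x ≠ b → y = a ∨ y = b)
    (hr : ∀ y, G.Adj a y → deg G a ≤ (L s(a, y)).card)
    (hL : ∀ x y, G.Adj x y → x ≠ a → y ≠ a → k ≤ (L s(x, y)).card) : ListColorable G L := by
  have hle : G.deleteEdges {s(a, b)} ≤ G := deleteEdges_le _
  have ha := deg_add_one_le hle hab (by simp)
  have hb := deg_add_one_le hle hab.symm (by simp)
  obtain ⟨α, hα⟩ : (L s(a, b)).Nonempty := Finset.card_pos.1 (by have := hr b hab; omega)
  refine listColorable_of_erase hα (listColorable_of_bipartition (k := k - 1) {a, b} ?_ ?_ a ?_ ?_)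
  · intro x y hxy
    rw [deleteEdges_adj] at hxy
    obtain ⟨hxy, hne⟩ := hxy
    have h1 := hbook x y hxy
    have h2 := hbook y x hxy.symm
    have := hxy.ne
    simp only [Set.mem_insert_iff, Set.mem_singleton_iff] at hne ⊢
    grind
  · intro v
    have := hk a
    have := hk b
    by_cases hva : v = a
    · subst hva
      omega
    by_cases hvb : v = b
    · subst hvb
      omega
    have := deg_le_two_of_forall fun y hy => hbook v y hy hva hvb
    have := deg_mono hle v
    omega
  · intro y hy
    have := hr y (hle hy)
    have := Finset.pred_card_le_card_erase (s := L s(a, y)) (a := α)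
    omega
  · intro x y hxy hx hy
    have := hL x y (hle hxy) hx hy
    have := Finset.pred_card_le_card_erase (s := L s(x, y)) (a := α)
    omega

open Classical in
lemma exists_listColorable_filter [Fintype V] (h3 : 3 ≤ k) (hab : G.Adj a b)
    (hbook : ∀ x y, G.Adj x y → x ≠ a → x ≠ b → y = a ∨ y = b)
    (ha : deg G a + 1 ≤ k) (hb : deg G b + 1 ≤ k)
    (hL : ∀ x y, G.Adj x y → k ≤ (L s(x, y)).card) {P Q : Finset ℕ} (hP : 2 ≤ P.card)
    (hQ : 2 ≤ Q.card) : ∃ p ∈ P, ∃ q ∈ Q, p ≠ q ∧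
      ListColorable G fun e => (L e).filter fun c => (a ∈ e → c ≠ p) ∧ (b ∈ e → c ≠ q) := by
  have hle : G.deleteEdges {s(a, b)} ≤ G := deleteEdges_le _
  have ha' := deg_add_one_le hle hab (by simp)
  have hb' := deg_add_one_le hle hab.symm (by simp)
  by_cases hx : k = 3 ∧ ∃ x, G.Adj a x ∧ G.Adj b x
  · obtain ⟨rfl, x, hax, hbx⟩ := hx
    obtain ⟨p, hp, q, hq, t, ht, f, hf, g, hg, h⟩ := exists_wheel_coloring hP hQ (hL a b hab)
      (hL a x hax) (hL b x hbx)
    have hNa : ∀ y, G.Adj a y → y = b ∨ y = x := by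
      intro y hy
      by_contra! hne
      have : ({b, x, y} : Set V) ⊆ G.neighborSet a := by
        rintro z (rfl | rfl | rfl) <;> assumption
      have := Set.ncard_le_ncard this
      rw [Set.ncard_eq_three.2 ⟨b, x, y, hbx.ne, hne.1.symm, hne.2.symm, rfl⟩] at this
      change 3 ≤ deg G a at this
      omega
    have hNb : ∀ y, G.Adj b y → y = a ∨ y = x := by
      intro y hy
      by_contra! hne
      have : ({a, x, y} : Set V) ⊆ G.neighborSet b := by
        rintro z (rfl | rfl | rfl)
        · exact hab.symm
        · assumption
        · assumption
      have := Set.ncard_le_ncard this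
      rw [Set.ncard_eq_three.2 ⟨a, x, y, hax.ne, hne.1.symm, hne.2.symm, rfl⟩] at this
      change 3 ≤ deg G b at this
      omega
    have hedge : ∀ y z, G.Adj y z → s(y, z) = s(a, b) ∨ s(y, z) = s(a, x) ∨ s(y, z) = s(b, x) := by
      intro y z hyz
      simp only [Sym2.eq_iff]
      by_cases hya : y = a
      · subst hya
        have := hNa z hyz
        tauto
      by_cases hyb : y = b
      · subst hyb
        have := hNb z hyz
        tauto
      rcases hbook y z hyz hya hyb with rfl | rfl
      · have := hNa y hyz.symm
        tauto
      · have := hNb y hyz.symm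
        tauto
    have n1 := hab.ne
    have n2 := hax.ne
    have n3 := hbx.ne
    have e1 : s(a, x) ≠ s(a, b) := by simp [n3.symm, n1]
    have e2 : s(b, x) ≠ s(a, b) := by simp [n1.symm, n2.symm]
    have e3 : s(b, x) ≠ s(a, x) := by simp [n1.symm, n3]
    refine ⟨p, hp, q, hq, h.1, fun e => if e = s(a, b) then t else if e = s(a, x) then f else g,
      ?_, ?_⟩
    · intro y z hyz
      rcases hedge y z hyz with h' | h' | h' <;> rw [h']
      · simp [ht, h.2.1.symm, h.2.2.1.symm]
      · simp [hf, e1, n1.symm, n3, h.2.2.2.1.symm]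
      · simp [hg, e2, e3, n1, n2, h.2.2.2.2.1.symm]
    · intro y z z' hyz hyz' hzz
      rcases hedge y z hyz with h' | h' | h' <;> rcases hedge y z' hyz' with h'' | h'' | h'' <;>
        rw [h', h''] <;> simp only [e1, e2, e3, if_true, if_false, ne_eq, not_true_eq_false] <;>
        first
        | exact hzz (Sym2.congr_right.1 (h'.trans h''.symm))
        | grind
  · obtain ⟨p, hp⟩ : P.Nonempty := Finset.card_pos.1 (by omega)
    obtain ⟨q, hq, hqp⟩ := exists_mem_ne hQ p
    obtain ⟨t, ht, htp, htq⟩ := exists_mem_ne_ne (h3.trans (hL a b hab)) p q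
    refine ⟨p, hp, q, hq, hqp.symm, listColorable_of_erase (a := a) (b := b) (α := t)
      (by simp [ht, htp, htq]) ?_⟩
    have hcard : ∀ x y, (G.deleteEdges {s(a, b)}).Adj x y → k - 2 ≤ (((L s(x, y)).filter fun c =>
        (a ∈ s(x, y) → c ≠ p) ∧ (b ∈ s(x, y) → c ≠ q)).erase t).card := by
      intro x y hxy
      have h1 := hL x y (hle hxy)
      have h2 := Finset.pred_card_le_card_erase (s := L s(x, y)) (a := t)
      rw [deleteEdges_adj] at hxy
      have hsub : ∀ s : ℕ, (∀ c, c ≠ s → (a ∈ s(x, y) → c ≠ p) ∧ (b ∈ s(x, y) → c ≠ q)) →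
          ((L s(x, y)).erase t).erase s ⊆ ((L s(x, y)).filter fun c =>
        (a ∈ s(x, y) → c ≠ p) ∧ (b ∈ s(x, y) → c ≠ q)).erase t := by
        intro s hs c hc
        simp only [Finset.mem_erase, Finset.mem_filter] at hc ⊢
        exact ⟨hc.2.1, hc.2.2, hs c hc.1⟩
      have hs : ∃ s : ℕ, ∀ c, c ≠ s → (a ∈ s(x, y) → c ≠ p) ∧ (b ∈ s(x, y) → c ≠ q) := by
        by_cases hbm : b ∈ s(x, y)
        · refine ⟨q, fun c hc => ⟨fun ham => absurd ?_ hxy.2, fun _ => hc⟩⟩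
          exact ((Sym2.mem_and_mem_iff hab.ne).1 ⟨ham, hbm⟩)
        · exact ⟨p, fun c hc => ⟨fun _ => hc, fun h => absurd h hbm⟩⟩
      obtain ⟨s, hs⟩ := hs
      have h4 := Finset.card_le_card (hsub s hs)
      have h5 := Finset.pred_card_le_card_erase (s := (L s(x, y)).erase t) (a := s)
      omega
    refine listColorable_of_bipartition (k := k - 2) {a, b} ?_ ?_ a ?_ ?_
    · intro x y hxy
      rw [deleteEdges_adj] at hxy
      obtain ⟨hxy, hne⟩ := hxy
      have h1 := hbook x y hxy
      have h2 := hbook y x hxy.symm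
      have := hxy.ne
      simp only [Set.mem_insert_iff, Set.mem_singleton_iff] at hne ⊢
      grind
    · intro v
      by_cases hva : v = a
      · subst hva
        omega
      by_cases hvb : v = b
      · subst hvb
        omega
      refine (deg_mono hle v).trans ?_
      by_cases hk4 : 4 ≤ k
      · have := deg_le_two_of_forall fun y hy => hbook v y hy hva hvb
        omega
      · have hk3 : k = 3 := by omega
        subst hk3
        change (G.neighborSet v).ncard ≤ 1
        refine (Set.ncard_le_one (Set.toFinite _)).2 fun y hy z hz => ?_
        have h1 := hbook v y hy hva hvb
        have h2 := hbook v z hz hva hvb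
        by_contra hyz
        refine hx ⟨rfl, v, ?_⟩
        rcases h1 with rfl | rfl <;> rcases h2 with rfl | rfl
        · exact absurd rfl hyz
        · exact ⟨Adj.symm hy, Adj.symm hz⟩
        · exact ⟨Adj.symm hz, Adj.symm hy⟩
        · exact absurd rfl hyz
    · intro y hy
      have := hcard a y hy
      omega
    · intro x y hxy _ _
      exact hcard x y hxy

/-- A book can be completed from a suitable partial colouring. -/
lemma listColorable_of_attachment [Fintype V] (h3 : 3 ≤ k) (W : Set V) (ha : a ∉ W) (hb : b ∉ W)
    (hab : G.Adj a b) (hka : deg G a ≤ k) (hkb : deg G b ≤ k) (hu : u ∈ W) (hv : v ∈ W)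
    (hau : G.Adj a u) (hbv : G.Adj b v)
    (hout : ∀ x y, G.Adj x y → x ∉ W → y ∈ W → (x = a ∧ y = u) ∨ (x = b ∧ y = v))
    (hbook : ∀ x y, G.Adj x y → x ∉ W → y ∉ W → x ≠ a → x ≠ b → y = a ∨ y = b)
    (hL : ∀ x y, G.Adj x y → x ∉ W → y ∉ W → k ≤ (L s(x, y)).card)
    {P Q : Finset ℕ} (hP : 2 ≤ P.card) (hQ : 2 ≤ Q.card)
    (hφ : ∀ p ∈ P, ∀ q ∈ Q, p ≠ q → ∃ φ : Sym2 V → ℕ, φ s(a, u) = p ∧ φ s(b, v) = q ∧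
      (∀ x y, G.Adj x y → x ∈ W → φ s(x, y) ∈ L s(x, y)) ∧
      ∀ x y z, G.Adj x y → G.Adj x z → x ∈ W → y ≠ z → φ s(x, y) ≠ φ s(x, z)) :
    ListColorable G L := by
  classical
  let G₁ : SimpleGraph V :=
    { Adj := fun x y => G.Adj x y ∧ (x ∈ W ∨ y ∈ W)
      symm := ⟨fun x y h => ⟨h.1.symm, h.2.symm⟩⟩
      loopless := ⟨fun x h => G.loopless.irrefl x h.1⟩ }
  let G₂ : SimpleGraph V :=
    { Adj := fun x y => G.Adj x y ∧ x ∉ W ∧ y ∉ W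
      symm := ⟨fun x y h => ⟨h.1.symm, h.2.2, h.2.1⟩⟩
      loopless := ⟨fun x h => G.loopless.irrefl x h.1⟩ }
  have hle : G₂ ≤ G := fun x y h => h.1
  have hda := deg_add_one_le hle hau (fun h => h.2.2 hu)
  have hdb := deg_add_one_le hle hbv (fun h => h.2.2 hv)
  obtain ⟨p, hp, q, hq, hpq, h⟩ := exists_listColorable_filter (G := G₂) (L := L) h3
    ⟨hab, ha, hb⟩ (fun x y h => hbook x y h.1 h.2.1 h.2.2) (hda.trans hka) (hdb.trans hkb)
    (fun x y h => hL x y h.1 h.2.1 h.2.2) hP hQ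
  obtain ⟨φ, hφa, hφb, hφ, hφ'⟩ := hφ p hp q hq hpq
  refine ListColorable.glue (G₁ := G₁) (G₂ := G₂) (φ := φ) ?_ ?_ ?_ (h.mono ?_)
  · intro x y hxy
    by_cases hx : x ∈ W ∨ y ∈ W
    · exact Or.inl ⟨hxy, hx⟩
    · exact Or.inr ⟨hxy, by tauto⟩
  · rintro x y ⟨hxy, hx | hy⟩
    · exact hφ x y hxy hx
    · rw [Sym2.eq_swap]
      exact hφ y x hxy.symm hy
  · intro x y z hxy hxz hyz
    by_cases hx : x ∈ W
    · exact hφ' x y z hxy.1 hxz.1 hx hyz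
    · have h1 := hout x y hxy.1 hx (hxy.2.resolve_left hx)
      have h2 := hout x z hxz.1 hx (hxz.2.resolve_left hx)
      have := hab.ne
      grind
  · intro x y hxy c hc
    simp only [Finset.mem_filter] at hc
    refine mem_availableColors.2 ⟨hc.1, fun x' y' hx' hxy' => ?_⟩
    have hx'W : x' ∉ W := by
      rcases Sym2.mem_iff.1 hx' with rfl | rfl
      · exact hxy.2.1
      · exact hxy.2.2
    rcases hout x' y' hxy'.1 hx'W (hxy'.2.resolve_left hx'W) with ⟨rfl, rfl⟩ | ⟨rfl, rfl⟩
    · rw [hφa]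
      exact (hc.2.1 hx').symm
    · rw [hφb]
      exact (hc.2.2 hx').symm

end Book

section Main

variable {V : Type*} [Fintype V] {G : SimpleGraph V} {L : Sym2 V → Finset ℕ} {a b c d r u v : V}
  {k : ℕ}

lemma IsK4.listColorable_of_mem (h : IsK4 G a b c d)
    (hG : ∀ x y, G.Adj x y → x ∈ ({a, b, c, d} : Set V))
    (hL : ∀ x y, G.Adj x y → 3 ≤ (L s(x, y)).card) {t : ℕ} (ht : t ∈ L s(a, b))
    (ht' : t ∈ L s(c, d)) : ListColorable G L := by
  classical
  obtain ⟨hab, hac, had, hbc, hbd, hcd⟩ := h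
  have hG' : ∀ x y, G.Adj x y → x = a ∨ x = b ∨ x = c ∨ x = d := fun x y h => by
    simpa using hG x y h
  have := hab.ne
  have := hac.ne
  have := had.ne
  have := hbc.ne
  have := hbd.ne
  have := hcd.ne
  have hE : ∀ x y, ((edge a b) ⊔ (edge c d)).Adj x y ↔ s(x, y) = s(a, b) ∨ s(x, y) = s(c, d) := by
    intro x y
    simp only [sup_adj, edge_adj, Sym2.eq_iff]
    grind
  refine ListColorable.glue (G₁ := edge a b ⊔ edge c d)
    (G₂ := G.deleteEdges {s(a, b), s(c, d)}) (φ := fun _ => t) ?_ ?_ ?_ ?_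
  · intro x y hxy
    rw [hE, deleteEdges_adj]
    by_cases hxy' : s(x, y) ∈ ({s(a, b), s(c, d)} : Set (Sym2 V))
    · exact Or.inl hxy'
    · exact Or.inr ⟨hxy, hxy'⟩
  · intro x y hxy
    rcases (hE x y).1 hxy with h | h <;> rw [h] <;> assumption
  · intro x y z hxy hxz hyz
    rw [hE] at hxy hxz
    simp only [Sym2.eq_iff] at hxy hxz
    grind
  · have hadj : ∀ x y, (G.deleteEdges {s(a, b), s(c, d)}).Adj x y →
        ((x = a ∨ x = b) ∧ (y = c ∨ y = d)) ∨ ((x = c ∨ x = d) ∧ (y = a ∨ y = b)) := by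
      intro x y hxy
      rw [deleteEdges_adj] at hxy
      obtain ⟨hxy, hne⟩ := hxy
      have h1 := hG' x y hxy
      have h2 := hG' y x hxy.symm
      have := hxy.ne
      simp only [Set.mem_insert_iff, Set.mem_singleton_iff, Sym2.eq_iff] at hne
      grind
    have hcard : ∀ x y, G.Adj x y → 2 ≤ (availableColors (edge a b ⊔ edge c d) (fun _ => t) L
        s(x, y)).card := by
      intro x y hxy
      have h1 := card_le_card_availableColors_add (L := L) (G₁ := edge a b ⊔ edge c d)
        (φ := fun _ => t) {t} s(x, y) (by simp)
      have h2 := hL x y hxy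
      rw [Finset.card_singleton] at h1
      omega
    have hdeg : ∀ x, deg (G.deleteEdges {s(a, b), s(c, d)}) x ≤ 2 := by
      intro x
      by_cases hx : x = a ∨ x = b
      · exact deg_le_two_of_forall (u := c) (v := d) fun y hy => by have := hadj x y hy; grind
      · exact deg_le_two_of_forall (u := a) (v := b) fun y hy => by have := hadj x y hy; grind
    refine listColorable_of_bipartition (k := 2) {a, b} ?_ hdeg a ?_ ?_
    · intro x y hxy
      have := hadj x y hxy
      simp only [Set.mem_insert_iff, Set.mem_singleton_iff]
      grind
    · exact fun y hy => (hdeg a).trans (hcard a y (deleteEdges_le _ hy))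
    · exact fun x y hy _ _ => hcard x y (deleteEdges_le _ hy)

lemma IsK4.listColorable (h : IsK4 G a b c d) (hG : ∀ x y, G.Adj x y → x ∈ ({a, b, c, d} : Set V))
    (hL : ∀ x y, G.Adj x y → 3 ≤ (L s(x, y)).card) : ListColorable G L := by
  classical
  have hh := h
  obtain ⟨hab, hac, had, hbc, hbd, hcd⟩ := hh
  by_cases h1 : Disjoint (L s(a, b)) (L s(c, d))
  swap
  · obtain ⟨t, ht, ht'⟩ := Finset.not_disjoint_iff.1 h1
    exact h.listColorable_of_mem hG hL ht ht'
  by_cases h2 : Disjoint (L s(a, c)) (L s(b, d))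
  swap
  · obtain ⟨t, ht, ht'⟩ := Finset.not_disjoint_iff.1 h2
    refine IsK4.listColorable_of_mem (a := a) (b := c) (c := b) (d := d)
      ⟨hac, hab, had, hbc.symm, hcd, hbd⟩ (fun x y hxy => ?_) hL ht ht'
    have := hG x y hxy
    simp only [Set.mem_insert_iff, Set.mem_singleton_iff] at this ⊢
    tauto
  by_cases h3 : Disjoint (L s(a, d)) (L s(b, c))
  swap
  · obtain ⟨t, ht, ht'⟩ := Finset.not_disjoint_iff.1 h3
    refine IsK4.listColorable_of_mem (a := a) (b := d) (c := b) (d := c)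
      ⟨had, hab, hac, hbd.symm, hcd.symm, hbc⟩ (fun x y hxy => ?_) hL ht ht'
    have := hG x y hxy
    simp only [Set.mem_insert_iff, Set.mem_singleton_iff] at this ⊢
    tauto
  obtain ⟨f, hf, f0, f1, f2, f3, f4, f5⟩ := exists_injective_of_disjoint (hL _ _ hab)
    (hL _ _ hcd) (hL _ _ hac) (hL _ _ hbd) (hL _ _ had) (hL _ _ hbc) h1 h2 h3
  have hcase : ∀ x y, G.Adj x y → ∃ i : Fin 6,
      s(x, y) = ![s(a, b), s(c, d), s(a, c), s(b, d), s(a, d), s(b, c)] i ∧ f i ∈ L s(x, y) := by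
    intro x y hxy
    have hx : x = a ∨ x = b ∨ x = c ∨ x = d := by simpa using hG x y hxy
    have hy : y = a ∨ y = b ∨ y = c ∨ y = d := by simpa using hG y x hxy.symm
    have key : s(x, y) = s(a, b) ∨ s(x, y) = s(c, d) ∨ s(x, y) = s(a, c) ∨ s(x, y) = s(b, d) ∨
        s(x, y) = s(a, d) ∨ s(x, y) = s(b, c) := by
      have := hxy.ne
      simp only [Sym2.eq_iff]
      grind
    rcases key with e | e | e | e | e | e <;> rw [e]
    · exact ⟨0, rfl, f0⟩
    · exact ⟨1, rfl, f1⟩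
    · exact ⟨2, rfl, f2⟩
    · exact ⟨3, rfl, f3⟩
    · exact ⟨4, rfl, f4⟩
    · exact ⟨5, rfl, f5⟩
  have hinj : Function.Injective ![s(a, b), s(c, d), s(a, c), s(b, d), s(a, d), s(b, c)] := by
    have := hab.ne
    have := hac.ne
    have := had.ne
    have := hbc.ne
    have := hbd.ne
    have := hcd.ne
    intro i j hij
    fin_cases i <;> fin_cases j <;> simp at hij ⊢ <;> grind
  refine ⟨fun e => if h : ∃ i, e = ![s(a, b), s(c, d), s(a, c), s(b, d), s(a, d), s(b, c)] i then
    f h.choose else 0, ?_, ?_⟩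
  · intro x y hxy
    obtain ⟨i, hi, hfi⟩ := hcase x y hxy
    have hex : ∃ i, s(x, y) = ![s(a, b), s(c, d), s(a, c), s(b, d), s(a, d), s(b, c)] i := ⟨i, hi⟩
    simp only [dif_pos hex]
    rwa [hinj (hex.choose_spec.symm.trans hi)]
  · intro x y z hxy hxz hyz
    obtain ⟨i, hi, -⟩ := hcase x y hxy
    obtain ⟨j, hj, -⟩ := hcase x z hxz
    have hex : ∃ i, s(x, y) = ![s(a, b), s(c, d), s(a, c), s(b, d), s(a, d), s(b, c)] i := ⟨i, hi⟩
    have hex' : ∃ i, s(x, z) = ![s(a, b), s(c, d), s(a, c), s(b, d), s(a, d), s(b, c)] i :=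
      ⟨j, hj⟩
    simp only [dif_pos hex, dif_pos hex']
    intro heq
    refine hyz (Sym2.congr_right.1 ((hex.choose_spec).trans ?_))
    rw [hf heq, ← hex'.choose_spec]

/-- The book with an additional page `r` of minimum degree two. -/
lemma listColorable_of_triangle_page (h3 : 3 ≤ k) (hk : ∀ v, deg G v ≤ k) (hab : G.Adj a b)
    (hra : G.Adj r a) (hrb : G.Adj r b)
    (hbook : ∀ x y, G.Adj x y → x ≠ a → x ≠ b → y = a ∨ y = b)
    (hr : ∀ y, G.Adj r y → deg G r ≤ (L s(r, y)).card)
    (hL : ∀ x y, G.Adj x y → x ≠ r → y ≠ r → k ≤ (L s(x, y)).card) : ListColorable G L := by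
  classical
  have hN : ∀ y, G.Adj r y → y = a ∨ y = b := fun y hy => hbook r y hy hra.ne hrb.ne
  have hd : 2 ≤ deg G r := by
    rw [← Set.ncard_pair hab.ne]
    exact Set.ncard_le_ncard (by rintro z (rfl | rfl) <;> assumption)
  have hne := hab.ne
  have hne1 := hra.ne
  have hne2 := hrb.ne
  refine listColorable_of_attachment (a := a) (b := b) (u := r) (v := r) h3 {r} hne1.symm
    hne2.symm hab (hk a) (hk b) rfl rfl hra.symm hrb.symm ?_ ?_ ?_
    (P := L s(r, a)) (Q := L s(r, b)) (hd.trans (hr a hra)) (hd.trans (hr b hrb)) ?_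
  · rintro x y hxy - rfl
    have := hN x hxy.symm
    tauto
  · exact fun x y hxy _ _ => hbook x y hxy
  · exact fun x y hxy hx hy => hL x y hxy hx hy
  · intro p hp q hq hpq
    have e : s(r, b) ≠ s(r, a) := by simp [hne.symm, hne1]
    refine ⟨fun e => if e = s(r, a) then p else q, ?_, ?_, ?_, ?_⟩
    · simp [Sym2.eq_swap]
    · simp [hne.symm, hne1]
    · rintro x y hxy rfl
      rcases hN y hxy with rfl | rfl
      · simpa using hp
      · simpa [e] using hq
    · rintro x y z hxy hxz rfl hyz
      rcases hN y hxy with rfl | rfl <;> rcases hN z hxz with rfl | rfl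
      · exact absurd rfl hyz
      · simpa [e] using hpq
      · simpa [e] using hpq.symm
      · exact absurd rfl hyz

/-- The book with an additional page consisting of a path `a`, `u`, `r`, `v`, `b`. -/
lemma listColorable_of_pentagon_page (h3 : 3 ≤ k) (hk : ∀ v, deg G v ≤ k) (hab : G.Adj a b)
    (hru : G.Adj r u) (hrv : G.Adj r v) (huv : u ≠ v) (hua : G.Adj u a) (hvb : G.Adj v b)
    (hra : r ≠ a) (hrb : r ≠ b) (hub : u ≠ b) (hva : v ≠ a)
    (hNr : ∀ y, G.Adj r y → y = u ∨ y = v) (hNu : ∀ y, G.Adj u y → y = r ∨ y = a)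
    (hNv : ∀ y, G.Adj v y → y = r ∨ y = b)
    (hbook : ∀ x y, G.Adj x y → x ≠ a → x ≠ b → x ≠ r → y = a ∨ y = b ∨ y = r)
    (hr : ∀ y, G.Adj r y → deg G r ≤ (L s(r, y)).card)
    (hL : ∀ x y, G.Adj x y → x ≠ r → y ≠ r → k ≤ (L s(x, y)).card) : ListColorable G L := by
  classical
  have hd : 2 ≤ deg G r := by
    rw [← Set.ncard_pair huv]
    exact Set.ncard_le_ncard (by rintro z (rfl | rfl) <;> assumption)
  obtain ⟨α, hα⟩ : (L s(r, u)).Nonempty := Finset.card_pos.1 (by have := hr u hru; omega)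
  obtain ⟨β, hβ, hβα⟩ := exists_mem_ne (hd.trans (hr v hrv)) α
  have n1 := hab.ne
  have n2 := hru.ne
  have n3 := hrv.ne
  have n4 := hua.ne
  have n5 := hvb.ne
  have hP := Finset.pred_card_le_card_erase (s := L s(u, a)) (a := α)
  have hQ := Finset.pred_card_le_card_erase (s := L s(v, b)) (a := β)
  have hP' := hL u a hua n2.symm hra.symm
  have hQ' := hL v b hvb n3.symm hrb.symm
  refine listColorable_of_attachment (a := a) (b := b) (u := u) (v := v) h3 {r, u, v}
    (by simp; tauto) (by simp; tauto) hab (hk a) (hk b) (by simp) (by simp) hua.symm hvb.symm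
    ?_ ?_ ?_ (P := (L s(u, a)).erase α) (Q := (L s(v, b)).erase β) (by omega) (by omega) ?_
  · intro x y hxy hx hy
    simp only [Set.mem_insert_iff, Set.mem_singleton_iff] at hx hy
    rcases hy with rfl | rfl | rfl
    · have := hNr x hxy.symm
      tauto
    · have := hNu x hxy.symm
      tauto
    · have := hNv x hxy.symm
      tauto
  · intro x y hxy hx hy hxa hxb
    simp only [Set.mem_insert_iff, Set.mem_singleton_iff] at hx hy
    have := hbook x y hxy hxa hxb
    tauto
  · intro x y hxy hx hy
    simp only [Set.mem_insert_iff, Set.mem_singleton_iff] at hx hy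
    exact hL x y hxy (by tauto) (by tauto)
  · intro p hp q hq hpq
    rw [Finset.mem_erase] at hp hq
    have e1 : s(u, a) ≠ s(r, u) := by simp; grind
    have e2 : s(u, a) ≠ s(r, v) := by simp; grind
    have e3 : s(v, b) ≠ s(r, u) := by simp; grind
    have e4 : s(v, b) ≠ s(r, v) := by simp; grind
    have e5 : s(v, b) ≠ s(u, a) := by simp; grind
    have e6 : s(r, v) ≠ s(r, u) := by simp; grind
    obtain ⟨φ, h1, h2, h4, h5⟩ : ∃ φ : Sym2 V → ℕ, φ s(r, u) = α ∧ φ s(r, v) = β ∧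
        φ s(u, a) = p ∧ φ s(v, b) = q :=
      ⟨fun e => if e = s(r, u) then α else if e = s(r, v) then β else if e = s(u, a) then p else q,
        by simp, by simp [e6], by simp [e1, e2], by simp only [e3, e4, e5, if_false]⟩
    refine ⟨φ, by rw [Sym2.eq_swap, h4], by rw [Sym2.eq_swap, h5], ?_, ?_⟩
    · intro x y hxy hx
      simp only [Set.mem_insert_iff, Set.mem_singleton_iff] at hx
      rcases hx with rfl | rfl | rfl
      · rcases hNr y hxy with rfl | rfl
        · rwa [h1]
        · rwa [h2]
      · rcases hNu y hxy with rfl | rfl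
        · rwa [Sym2.eq_swap, h1]
        · rw [h4]
          exact hp.2
      · rcases hNv y hxy with rfl | rfl
        · rwa [Sym2.eq_swap, h2]
        · rw [h5]
          exact hq.2
    · intro x y z hxy hxz hx hyz
      simp only [Set.mem_insert_iff, Set.mem_singleton_iff] at hx
      rcases hx with rfl | rfl | rfl
      · have := hNr y hxy
        have := hNr z hxz
        grind
      · have := hNu y hxy
        have := hNu z hxz
        have : φ s(x, r) = α := by rw [Sym2.eq_swap, h1]
        grind
      · have := hNv y hxy
        have := hNv z hxz
        have : φ s(x, r) = β := by rw [Sym2.eq_swap, h2]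
        grind

/-- There is no book with an additional page of length three, because of parity. -/
lemma InGStar.not_square_page (hG : InGStar G) (hN : Nonseparable G) (h2 : ¬ G.Colorable 2)
    (hab : G.Adj a b) (hra : G.Adj r a) (hrv : G.Adj r v) (hrb : r ≠ b) (hva : v ≠ a) (hvb : v ≠ b)
    (hNr : ∀ y, G.Adj r y → y = a ∨ y = v)
    (hNv : ∃ c, (c = a ∨ c = b) ∧ G.Adj v c ∧ ∀ y, G.Adj v y → y = r ∨ y = c)
    (hbook : ∀ x y, G.Adj x y → x ≠ a → x ≠ b → x ≠ r → y = a ∨ y = b ∨ y = r) : False := by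
  have n1 := hab.ne
  have n2 := hra.ne
  have n3 := hrv.ne
  obtain ⟨c, rfl | rfl, hvc, hNv⟩ := hNv
  · have hU : ∀ z ∈ ({r, v, c} : Set V), z ≠ c → ∀ t, G.Adj z t → t ∈ ({r, v, c} : Set V) := by
      intro z hz hzc t ht
      simp only [Set.mem_insert_iff, Set.mem_singleton_iff] at hz ⊢
      rcases hz with rfl | rfl | rfl
      · have := hNr t ht
        tauto
      · have := hNv t ht
        tauto
      · exact absurd rfl hzc
    have := hN.mem_of_adj c hU (by simp) (by simp) hrv hab.symm
    simp only [Set.mem_insert_iff, Set.mem_singleton_iff] at this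
    grind
  · by_cases hx : ∃ x, G.Adj x a ∧ G.Adj x c ∧ x ≠ r
    · obtain ⟨x, hxa, hxc, hxr⟩ := hx
      have hxv : x ≠ v := by
        rintro rfl
        have := hNv a hxa
        tauto
      have hQ := (HasPath.of_adj hxa.symm).append (HasPath.of_adj hxc) (by
        have := hxa.ne
        have := hxc.ne
        simp only [Set.mem_insert_iff, Set.mem_singleton_iff]
        grind)
      have hS := ((HasPath.of_adj hra.symm).append (HasPath.of_adj hrv) (by
        simp only [Set.mem_insert_iff, Set.mem_singleton_iff]
        grind)).append (HasPath.of_adj hvc) (by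
        simp only [Set.mem_insert_iff, Set.mem_singleton_iff, Set.mem_union]
        grind)
      have := hG.theta n1 (HasPath.of_adj hab) hS hQ
        (by simp only [Set.mem_insert_iff, Set.mem_singleton_iff, Set.mem_union]; grind)
        (by simp only [Set.mem_insert_iff, Set.mem_singleton_iff, Set.mem_union]; grind)
        (by simp only [Set.mem_insert_iff, Set.mem_singleton_iff, Set.mem_union]; grind)
        (by decide) (by decide) (by decide)
      omega
    · push Not at hx
      refine h2 (colorable_two_of_bipartition
        {x | x = a ∨ (x ≠ a ∧ x ≠ c ∧ x ≠ r ∧ G.Adj x c)} ?_)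
      have key : ∀ x y, G.Adj x y → x ≠ a → x ≠ c → x ≠ r →
          (y = a ∧ ¬ G.Adj x c) ∨ (y = c ∧ G.Adj x c) ∨ (y = r ∧ G.Adj x c) := by
        intro x y hxy hxa hxc hxr
        rcases hbook x y hxy hxa hxc hxr with rfl | rfl | rfl
        · exact Or.inl ⟨rfl, fun h => hxr (hx x hxy h)⟩
        · exact Or.inr (Or.inl ⟨rfl, hxy⟩)
        · rcases hNr x hxy.symm with rfl | rfl
          · exact absurd rfl hxa
          · exact Or.inr (Or.inr ⟨rfl, hvc⟩)
      have hrc : ¬ G.Adj r c := fun h => by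
        have := hNr c h
        grind
      intro x y hxy
      have h1 := key x y hxy
      have h2 := key y x hxy.symm
      have h3 := hxy.ne
      have h4 : ¬ (x = r ∧ y = c) := by
        rintro ⟨rfl, rfl⟩
        exact hrc hxy
      have h5 : ¬ (x = c ∧ y = r) := by
        rintro ⟨rfl, rfl⟩
        exact hrc hxy.symm
      have h6 := hxy.symm
      simp only [Set.mem_ofPred_eq]
      by_cases hxa : x = a
      · grind
      by_cases hxc : x = c
      · grind
      by_cases hxr : x = r <;> grind

end Main

section Conclusion

variable {V : Type*} [Fintype V] {G : SimpleGraph V} {L : Sym2 V → Finset ℕ} {a b r : V} {k : ℕ}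

lemma InGStar.listColorable_of_page (hG : InGStar G) (hN : Nonseparable G) (h2 : ¬ G.Colorable 2)
    (h3 : 3 ≤ k) (hk : ∀ v, deg G v ≤ k) (hab : G.Adj a b) (hra : r ≠ a) (hrb : r ≠ b)
    (hr1 : ∃ y, G.Adj r y)
    (htwo : ∀ x, x ≠ a → x ≠ b → ∃ u v, ∀ y, G.Adj x y → y = u ∨ y = v)
    (hbook : ∀ x y, G.Adj x y → x ≠ a → x ≠ b → x ≠ r → y = a ∨ y = b ∨ y = r)
    (hr : ∀ y, G.Adj r y → deg G r ≤ (L s(r, y)).card)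
    (hL : ∀ x y, G.Adj x y → x ≠ r → y ≠ r → k ≤ (L s(x, y)).card) : ListColorable G L := by
  obtain ⟨u, v, hru, hrv, huv, hNr⟩ : ∃ u v, G.Adj r u ∧ G.Adj r v ∧ u ≠ v ∧
      ∀ y, G.Adj r y → y = u ∨ y = v := by
    obtain ⟨u, v, huv⟩ := htwo r hra hrb
    obtain ⟨y, hy⟩ := hr1
    obtain ⟨z, hzy, hz⟩ := hN.exists_adj_ne h2 hy
    exact ⟨y, z, hy, hz, hzy.symm, by grind⟩
  have hnext : ∀ x, G.Adj r x → x ≠ a → x ≠ b → ∃ c, (c = a ∨ c = b) ∧ G.Adj x c ∧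
      ∀ y, G.Adj x y → y = r ∨ y = c := by
    intro x hrx hxa hxb
    obtain ⟨c, hcr, hxc⟩ := hN.exists_adj_ne h2 hrx.symm
    have hc := hbook x c hxc hxa hxb hrx.ne'
    obtain ⟨u, v, huv⟩ := htwo x hxa hxb
    have := huv r hrx.symm
    have := huv c hxc
    exact ⟨c, by tauto, hxc, by grind⟩
  have hbook' : ∀ x y, G.Adj x y → x ≠ b → x ≠ a → x ≠ r → y = b ∨ y = a ∨ y = r := by
    intro x y hxy h1 h2 h3
    have := hbook x y hxy h2 h1 h3
    tauto
  have hsquare : ∀ u v, G.Adj r u → G.Adj r v → (∀ y, G.Adj r y → y = u ∨ y = v) →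
      (u = a ∨ u = b) → v = a ∨ v = b := by
    intro u v hru hrv hNr hu
    by_contra! hv
    obtain ⟨c, hc, hvc, hNv⟩ := hnext v hrv hv.1 hv.2
    rcases hu with rfl | rfl
    · exact hG.not_square_page hN h2 hab hru hrv hrb hv.1 hv.2 hNr ⟨c, hc, hvc, hNv⟩ hbook
    · exact hG.not_square_page hN h2 hab.symm hru hrv hra hv.2 hv.1 hNr
        ⟨c, hc.symm, hvc, hNv⟩ hbook'
  by_cases hu : u = a ∨ u = b
  · have hv := hsquare u v hru hrv hNr hu
    refine listColorable_of_triangle_page h3 hk hab (r := r) (by grind) (by grind)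
      (fun x y hxy hxa hxb => ?_) hr hL
    by_cases hxr : x = r
    · subst hxr
      have := hNr y hxy
      grind
    · have h1 := hbook x y hxy hxa hxb hxr
      by_cases hyr : y = r
      · subst hyr
        have := hNr x hxy.symm
        grind
      · tauto
  · have hv : ¬ (v = a ∨ v = b) := fun hv =>
      hu (hsquare v u hrv hru (fun y hy => (hNr y hy).symm) hv)
    push Not at hu hv
    obtain ⟨c, hc, huc, hNu⟩ := hnext u hru hu.1 hu.2
    obtain ⟨d, hd, hvd, hNv⟩ := hnext v hrv hv.1 hv.2
    have hcd : c ≠ d := by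
      rintro rfl
      have hU : ∀ z ∈ ({r, u, v, c} : Set V), z ≠ c → ∀ t, G.Adj z t →
          t ∈ ({r, u, v, c} : Set V) := by
        intro z hz hzc t ht
        simp only [Set.mem_insert_iff, Set.mem_singleton_iff] at hz ⊢
        rcases hz with rfl | rfl | rfl | rfl
        · have := hNr t ht
          tauto
        · have := hNu t ht
          tauto
        · have := hNv t ht
          tauto
        · exact absurd rfl hzc
      have h1 := hN.mem_of_adj c hU (by simp) (by simp) hrv hab
      have h2 := hN.mem_of_adj c hU (by simp) (by simp) hrv hab.symm
      have := hab.ne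
      simp only [Set.mem_insert_iff, Set.mem_singleton_iff] at h1 h2
      grind
    rcases hc with rfl | rfl
    · obtain rfl : d = b := hd.resolve_left hcd.symm
      exact listColorable_of_pentagon_page h3 hk hab hru hrv huv huc hvd hra hrb hu.2 hv.1 hNr hNu
        hNv hbook hr hL
    · obtain rfl : d = a := hd.resolve_right hcd.symm
      exact listColorable_of_pentagon_page h3 hk hab.symm hru hrv huv huc hvd hrb hra hu.1 hv.2 hNr
        hNu hNv hbook' hr hL

lemma InGStar.listColorable_of_nonseparable (hG : InGStar G) (hN : Nonseparable G)
    (h2 : ¬ G.Colorable 2) (h3 : 3 ≤ k) (hk : ∀ v, deg G v ≤ k)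
    (hR : ∀ x y, G.Adj x y → x ≠ r → y ≠ r → k + 2 ≤ deg G x + deg G y)
    (hr : ∀ y, G.Adj r y → deg G r ≤ (L s(r, y)).card)
    (hL : ∀ x y, G.Adj x y → x ≠ r → y ≠ r → k ≤ (L s(x, y)).card) : ListColorable G L := by
  rcases hG.exists_isK4_or_book hN h2 with ⟨a, b, c, d, hK, hE⟩ | ⟨a, b, hab, htwo⟩
  · refine hK.listColorable hE fun x y hxy => ?_
    have hdeg : ∀ x y, G.Adj x y → 3 ≤ deg G x := by
      intro x y hxy
      have hx : x = a ∨ x = b ∨ x = c ∨ x = d := by simpa using hE x y hxy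
      obtain ⟨hab, hac, had, hbc, hbd, hcd⟩ := hK
      have key : ∀ {x y z t : V}, G.Adj x y → G.Adj x z → G.Adj x t → y ≠ z → y ≠ t → z ≠ t →
          3 ≤ deg G x := by
        intro x y z t hy hz ht h1 h2 h3
        rw [← Set.ncard_eq_three.2 ⟨y, z, t, h1, h2, h3, rfl⟩]
        refine Set.ncard_le_ncard ?_
        rintro w (rfl | rfl | rfl) <;> assumption
      rcases hx with rfl | rfl | rfl | rfl
      · exact key hab hac had hbc.ne hbd.ne hcd.ne
      · exact key hab.symm hbc hbd hac.ne had.ne hcd.ne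
      · exact key hac.symm hbc.symm hcd hab.ne had.ne hbd.ne
      · exact key had.symm hbd.symm hcd.symm hab.ne hac.ne hbc.ne
    by_cases hxr : x = r
    · subst hxr
      exact (hdeg x y hxy).trans (hr y hxy)
    by_cases hyr : y = r
    · subst hyr
      rw [Sym2.eq_swap]
      exact (hdeg y x hxy.symm).trans (hr x hxy.symm)
    exact h3.trans (hL x y hxy hxr hyr)
  have hbook : ∀ x y, G.Adj x y → x ≠ a → x ≠ b → x ≠ r → y = a ∨ y = b ∨ y = r := by
    intro x y hxy hxa hxb hxr
    by_contra! hy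
    obtain ⟨u, v, huv⟩ := htwo x hxa hxb
    obtain ⟨u', v', huv'⟩ := htwo y hy.1 hy.2.1
    have := deg_le_two_of_forall huv
    have := deg_le_two_of_forall huv'
    have := hR x y hxy hxr hy.2.2
    omega
  by_cases hra : r = a
  · subst hra
    refine listColorable_of_book h3 hk hab (fun x y hxy h1 h2 => ?_) hr hL
    have := hbook x y hxy h1 h2 h1
    tauto
  by_cases hrb : r = b
  · subst hrb
    refine listColorable_of_book h3 hk hab.symm (fun x y hxy h1 h2 => ?_) hr hL
    have := hbook x y hxy h2 h1 h1
    tauto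
  by_cases hr1 : ∃ y, G.Adj r y
  · exact hG.listColorable_of_page hN h2 h3 hk hab hra hrb hr1 htwo hbook hr hL
  · push Not at hr1
    have hL' : ∀ x y, G.Adj x y → k ≤ (L s(x, y)).card := by
      intro x y hxy
      refine hL x y hxy ?_ ?_
      · rintro rfl
        exact hr1 y hxy
      · rintro rfl
        exact hr1 x hxy.symm
    refine listColorable_of_book h3 hk hab (fun x y hxy h1 h2 => ?_)
      (fun y hy => (hk a).trans (hL' a y hy)) (fun x y hxy _ _ => hL' x y hxy)
    by_cases hxr : x = r
    · subst hxr
      exact absurd hxy (hr1 y)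
    · have := hbook x y hxy h1 h2 hxr
      have : y ≠ r := by
        rintro rfl
        exact hr1 x hxy.symm
      tauto

theorem InGStar.rootListColorable (h3 : 3 ≤ k) (G : SimpleGraph V) (hG : InGStar G)
    (hk : ∀ v, deg G v ≤ k) : RootListColorable G k := by
  induction G using WellFoundedLT.induction with
  | ind G ih =>
  have ih' : ∀ H, H < G → RootListColorable H k := fun H hH =>
    ih H hH (hG.mono hH.le) fun v => (deg_mono hH.le v).trans (hk v)
  by_cases hN : Nonseparable G
  · intro r L hr hL
    by_cases h2 : G.Colorable 2
    · obtain ⟨S, hS⟩ := exists_bipartition_of_colorable h2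
      exact listColorable_of_bipartition S hS hk r hr hL
    by_cases hR : ∀ x y, G.Adj x y → x ≠ r → y ≠ r → k + 2 ≤ deg G x + deg G y
    · exact hG.listColorable_of_nonseparable hN h2 h3 hk hR hr hL
    · push Not at hR
      obtain ⟨x, y, hxy, hxr, hyr, hd⟩ := hR
      have hle : G.deleteEdges {s(x, y)} ≤ G := deleteEdges_le _
      have hlt : G.deleteEdges {s(x, y)} < G := by
        refine lt_of_le_of_ne hle fun h => ?_
        rw [← h] at hxy
        simp at hxy
      refine listColorable_of_deleteEdges hxy (ih' _ hlt r L
        (fun z hz => (deg_mono hle r).trans (hr z (hle hz)))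
        (fun z w hzw => hL z w (hle hzw))) ?_
      have := hL x y hxy hxr hyr
      omega
  · unfold Nonseparable at hN
    push Not at hN
    obtain ⟨w, G₁, G₂, rfl, hw, h₁, h₂⟩ := hN
    have key : ∀ {G₁ G₂ : SimpleGraph V}, (∀ v, v ≠ w → ∀ x y, G₁.Adj v x → ¬ G₂.Adj v y) →
        G₂ ≠ ⊥ → G₁ < G₁ ⊔ G₂ := by
      intro G₁ G₂ hw h
      refine left_lt_sup.2 fun hle => ?_
      obtain ⟨x, y, hxy⟩ := ne_bot_iff_exists_adj.1 h
      by_cases hx : x = w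
      · exact hw y (by rw [← hx]; exact hxy.ne') x x (hle hxy).symm hxy.symm
      · exact hw x hx y y (hle hxy) hxy
    exact RootListColorable.of_separation rfl hw hk (ih' _ (key hw h₂))
      (ih' _ (sup_comm G₁ G₂ ▸ key (fun v hv x y hx hy => hw v hv y x hy hx) h₁))

end Conclusion

section Transfer

variable {V : Type*} {G : SimpleGraph V} {k : ℕ}

lemma ListColorable.fEdgeChoosable {f : ℕ} (h : ∀ L : Sym2 V → Finset ℕ,
    (∀ x y, G.Adj x y → f ≤ (L s(x, y)).card) → ListColorable G L) :
    FEdgeChoosable G fun _ => f := by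
  classical
  intro ℓ hℓ
  obtain ⟨φ, hφ, hφ'⟩ := h (fun e => if he : e ∈ G.edgeSet then ℓ ⟨e, he⟩ else ∅) (by
    intro x y hxy
    have : s(x, y) ∈ G.edgeSet := hxy
    simpa only [dif_pos this] using hℓ ⟨s(x, y), hxy⟩)
  refine ⟨fun e => φ e, ?_, ?_⟩
  · rintro ⟨e, he⟩
    induction e with | _ x y =>
    have := hφ x y he
    simpa only [dif_pos he] using this
  · rintro ⟨e, he⟩ ⟨f, hf⟩ ⟨hne, x, hxe, hxf⟩
    obtain ⟨y, rfl⟩ := Sym2.mem_iff_exists.1 hxe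
    obtain ⟨z, rfl⟩ := Sym2.mem_iff_exists.1 hxf
    exact hφ' x y z he hf fun hyz => hne (by subst hyz; rfl)

lemma deg_le_of_coloring {φ : G.edgeSet → ℕ} (hφ : ∀ e, φ e < k)
    (hφ' : ∀ e₁ e₂, lineAdj G e₁ e₂ → φ e₁ ≠ φ e₂) (v : V) : deg G v ≤ k := by
  classical
  rw [deg, ← Finset.card_range k, ← Set.ncard_coe_finset]
  refine Set.ncard_le_ncard_of_injOn
    (fun y => if h : G.Adj v y then φ ⟨s(v, y), h⟩ else 0) ?_ ?_
  · intro y hy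
    have hy' : G.Adj v y := hy
    simpa [hy'] using hφ _
  · intro y hy z hz heq
    have hy' : G.Adj v y := hy
    have hz' : G.Adj v z := hz
    simp only [dif_pos hy', dif_pos hz'] at heq
    by_contra hyz
    refine hφ' ⟨s(v, y), hy'⟩ ⟨s(v, z), hz'⟩ ⟨fun h => hyz ?_, v, by simp, by simp⟩ heq
    exact Sym2.congr_right.1 (congrArg Subtype.val h)

lemma even_of_isPath {c : Sym2 V → ℕ} (hc : ∀ x y, G.Adj x y → c s(x, y) < 2)
    (hc' : ∀ x y z, G.Adj x y → G.Adj x z → y ≠ z → c s(x, y) ≠ c s(x, z)) {x y t : V}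
    (p : G.Walk x y) (hp : p.IsPath) (ht : G.Adj y t) (htp : t ∉ p.support) :
    ∀ z, G.Adj x z → z ∉ p.support → (p.length = 0 → z ≠ t) →
      Even (c s(x, z) + c s(y, t) + p.length + 1) := by
  induction p with
  | @nil x =>
    intro z hz _ hzt
    have h1 := hc x z hz
    have h2 := hc x t ht
    have h3 := hc' x z t hz ht (hzt rfl)
    rw [Walk.length_nil, Nat.even_iff]
    omega
  | @cons x w y h p ih =>
    intro z hz hzp _
    rw [Walk.cons_isPath_iff] at hp
    rw [Walk.support_cons, List.mem_cons, not_or] at htp hzp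
    have h1 := ih hp.1 ht htp.2 x h.symm hp.2 fun _ => Ne.symm htp.1
    have h2 := hc x z hz
    have h3 := hc x w h
    have h4 := hc' x z w hz h fun hzw => hzp.2 (hzw ▸ p.start_mem_support)
    rw [Sym2.eq_swap] at h1
    rw [Walk.length_cons]
    rw [Nat.even_iff] at h1 ⊢
    omega

lemma colorable_two_of_coloring {φ : G.edgeSet → ℕ} (hφ : ∀ e, φ e < 2)
    (hφ' : ∀ e₁ e₂, lineAdj G e₁ e₂ → φ e₁ ≠ φ e₂) : G.Colorable 2 := by
  classical
  by_contra h
  obtain ⟨c, hc, hc'⟩ : ∃ c : Sym2 V → ℕ, (∀ x y, G.Adj x y → c s(x, y) < 2) ∧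
      ∀ x y z, G.Adj x y → G.Adj x z → y ≠ z → c s(x, y) ≠ c s(x, z) := by
    refine ⟨fun e => if h : e ∈ G.edgeSet then φ ⟨e, h⟩ else 0, fun x y hxy => ?_,
      fun x y z hxy hxz hyz => ?_⟩
    · have : s(x, y) ∈ G.edgeSet := hxy
      simpa only [dif_pos this] using hφ _
    · have hy : s(x, y) ∈ G.edgeSet := hxy
      have hz : s(x, z) ∈ G.edgeSet := hxz
      simp only [dif_pos hy, dif_pos hz]
      exact hφ' _ _ ⟨fun h => hyz (Sym2.congr_right.1 (congrArg Subtype.val h)), x, by simp, by simp⟩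
  obtain ⟨a, b, n, A, hab, ⟨p, hp, rfl, -⟩, hn⟩ := exists_odd_cycle_of_not_colorable h
  cases p with
  | nil => exact hab.ne rfl
  | @cons _ w _ h p =>
    rw [Walk.cons_isPath_iff] at hp
    rw [Walk.length_cons, Nat.even_iff] at hn
    have h1 := even_of_isPath hc hc' p hp.1 hab.symm hp.2 a h.symm hp.2 (by omega)
    have h2 := hc' a w b h hab fun hwb => by
      subst hwb
      rw [Walk.length_eq_zero_iff.2 (Walk.isPath_iff_nil.1 hp.1)] at hn
      simp at hn
    have h3 := hc a w h
    have h4 := hc a b hab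
    rw [Sym2.eq_swap, Sym2.eq_swap (a := b), Nat.even_iff] at h1
    omega

end Transfer

/-- for `G ∈ G*`, the list chromatic index equals the chromatic
index. -/
theorem stmt18 {V : Type*} [Fintype V] (G : SimpleGraph V) (hG : InGStar G) :
    listChromIndex G = chromIndex G := by
  have hsub : ∀ n, FEdgeChoosable G (fun _ => n) → ∃ φ : G.edgeSet → ℕ, (∀ e, φ e < n) ∧
      ∀ e₁ e₂, lineAdj G e₁ e₂ → φ e₁ ≠ φ e₂ := by
    intro n hn
    obtain ⟨φ, hφ, hφ'⟩ := hn (fun _ => Finset.range n) (by simp)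
    exact ⟨φ, by simpa using hφ, hφ'⟩
  have hsup : ∀ n, (∃ φ : G.edgeSet → ℕ, (∀ e, φ e < n) ∧
      ∀ e₁ e₂, lineAdj G e₁ e₂ → φ e₁ ≠ φ e₂) → FEdgeChoosable G (fun _ => n) := by
    rintro n ⟨φ, hφ, hφ'⟩
    refine ListColorable.fEdgeChoosable fun L hL => ?_
    have hdeg := deg_le_of_coloring hφ hφ'
    cases isEmpty_or_nonempty V with
    | inl hV => exact ⟨fun _ => 0, fun x => hV.elim x, fun x => hV.elim x⟩
    | inr hV =>
      obtain ⟨r⟩ := hV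
      have hr : ∀ y, G.Adj r y → deg G r ≤ (L s(r, y)).card :=
        fun y hy => (hdeg r).trans (hL r y hy)
      by_cases h2 : G.Colorable 2
      · obtain ⟨S, hS⟩ := exists_bipartition_of_colorable h2
        exact listColorable_of_bipartition S hS hdeg r hr fun x y hxy _ _ => hL x y hxy
      · have h3 : 3 ≤ n := by
          by_contra hn
          exact h2 (colorable_two_of_coloring (fun e => (hφ e).trans_le (by omega)) hφ')
        exact hG.rootListColorable h3 G hdeg r L hr fun x y hxy _ _ => hL x y hxy
  rw [listChromIndex, chromIndex]
  congr 1
  ext n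
  exact ⟨hsub n, hsup n⟩
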